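/- arXiv:1007.3931 — 4 statements merged into one kernel-verified Lean document; each statement's English description precedes it below -/
import Mathlib

section
/- Let n ≥ 1 and let A, B, S be real n×n matrices such that: S is symmetric and positive definite; the product S·A is a symmetric matrix; the characteristic polynomial of A has n distinct real roots; and there exists α > 0 such that vᵀ S B v ≥ α‖v‖² for every v ∈ ℝⁿ. Then B is invertible, the number of eigenvalues of A with strictly positive real part (roots over ℂ of the characteristic polynomial of A, counted with multiplicity) equals the number of eigenvalues of B⁻¹A with strictly positive real part, and the number of eigenvalues of A with strictly negative real part equals the number of eigenvalues of B⁻¹A with strictly negative real part. -/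
open Matrix Polynomial

/-- The number of roots over `ℂ` (with multiplicity) of the characteristic polynomial of a
real matrix `M` whose real part satisfies the (decidable) predicate `p`. -/
noncomputable def eigCount {n : ℕ} (M : Matrix (Fin n) (Fin n) ℝ) (p : ℝ → Prop)
    [DecidablePred p] : ℕ :=
  ((M.charpoly.map (algebraMap ℝ ℂ)).roots.filter fun z => p z.re).card

section Lyapunov

variable {V : Type*} [AddCommGroup V] [Module ℂ V]

/-- If `f v = l • v` and `f x = m • x` modulo `v`, with `x` not a multiple of `v`, then `m` is an
eigenvalue of `f`. -/
lemma hasEigenvalue_of_apply_eq_add_smul {f : Module.End ℂ V} {v x : V} {l m c : ℂ}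
    (hv0 : v ≠ 0) (hx : ∀ a : ℂ, x + a • v ≠ 0) (hv : f v = l • v)
    (hfx : f x = m • x + c • v) : f.HasEigenvalue m := by
  rcases eq_or_ne m l with rfl | hne
  · exact Module.End.hasEigenvalue_of_hasEigenvector
      ⟨Module.End.mem_eigenspace_iff.mpr hv, hv0⟩
  · have hml : m - l ≠ 0 := sub_ne_zero.mpr hne
    refine Module.End.hasEigenvalue_of_hasEigenvector (x := x + (c / (m - l)) • v)
      ⟨Module.End.mem_eigenspace_iff.mpr ?_, hx _⟩
    rw [map_add, map_smul, hv, hfx, smul_add, add_assoc, smul_smul, smul_smul, ← add_smul]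
    congr 2
    field_simp
    ring

/-- Lyapunov's theorem: if `Re h(x, f x) > 0` for `x ≠ 0` and the real parts of all eigenvalues
of `f` have the sign of `s`, then the Hermitian form `h` is definite with the sign of `s`. -/
theorem lyapunov_definite [FiniteDimensional ℂ V] (s : ℝ)
    (h : V →ₗ⋆[ℂ] V →ₗ[ℂ] ℂ) (hh : ∀ x y, star (h x y) = h y x) (f : Module.End ℂ V)
    (hf : ∀ x, x ≠ 0 → 0 < (h x (f x)).re)
    (hs : ∀ μ, f.HasEigenvalue μ → 0 < s * μ.re) (x : V) (hx : x ≠ 0) :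
    0 < s * (h x x).re := by
  induction hd : Module.finrank ℂ V using Nat.strong_induction_on generalizing V with
  | _ d ih =>
  have : Nontrivial V := ⟨x, 0, hx⟩
  obtain ⟨l, hl⟩ := Module.End.exists_eigenvalue f
  obtain ⟨v, hv⟩ := hl.exists_hasEigenvector
  have him : ∀ y, (h y y).im = 0 := fun y => Complex.conj_eq_iff_im.mp (hh y y)
  have hvv : 0 < s * (h v v).re := by
    have h1 := hf v hv.2
    have h2 := hs l hl
    rw [hv.apply_eq_smul, map_smul, smul_eq_mul, Complex.mul_re, him, mul_zero, sub_zero] at h1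
    by_contra hcon
    nlinarith [mul_pos h1 h2, mul_self_nonneg l.re]
  have hvne : h v v ≠ 0 := fun h0 => by simp [h0] at hvv
  let W : Submodule ℂ V := LinearMap.ker (h v)
  let P : V →ₗ[ℂ] V := LinearMap.id - ((h v v)⁻¹ • h v).smulRight v
  have hP : ∀ y, P y = y - ((h v v)⁻¹ * h v y) • v := fun y => by simp [P]
  have hPW : ∀ y, P y ∈ W := fun y => by
    simp only [W, LinearMap.mem_ker, hP, map_sub, map_smul, smul_eq_mul]
    field_simp
    ring
  have hleft : ∀ y ∈ W, h y v = 0 := fun y hy => by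
    rw [← hh, LinearMap.mem_ker.mp hy, star_zero]
  have hWlt : Module.finrank ℂ W < d := by
    rw [← hd]
    refine Submodule.finrank_lt fun htop => hvne ?_
    exact LinearMap.mem_ker.mp (htop ▸ Submodule.mem_top : v ∈ W)
  have key : ∀ y ∈ W, y ≠ 0 → 0 < s * (h y y).re := by
    intro y hy hy0
    refine ih _ hWlt (h.domRestrict₁₂ W W) (fun a b => hh a b)
      ((P ∘ₗ f ∘ₗ W.subtype).codRestrict W fun a => hPW _) ?_ ?_ ⟨y, hy⟩ (by simpa using hy0) rfl
    · intro a ha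
      have := hf a (by simpa using ha)
      simpa [LinearMap.domRestrict₁₂_apply, hP, hleft a a.2] using this
    · intro μ hμ
      obtain ⟨a, ha⟩ := hμ.exists_hasEigenvector
      have hfa : f a = μ • (a : V) + ((h v v)⁻¹ * h v (f a)) • v := by
        rw [← sub_eq_iff_eq_add, ← hP]
        exact congrArg Subtype.val ha.apply_eq_smul
      refine hs μ (hasEigenvalue_of_apply_eq_add_smul hv.2 ?_ hv.apply_eq_smul hfa)
      intro c hc
      have hva : h v a = 0 := a.2
      have h1 := congrArg (h v) hc
      simp only [map_add, map_smul, hva, zero_add, smul_eq_mul, map_zero, mul_eq_zero, hvne,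
        or_false] at h1
      exact ha.2 (by simpa [h1] using hc)
  set c := (h v v)⁻¹ * h v x
  have hdec : x = P x + c • v := by rw [hP, sub_add_cancel]
  have hexp : h x x = h (P x) (P x) + (Complex.normSq c : ℂ) * h v v := by
    have h1 : h v (P x) = 0 := hPW x
    conv_lhs => rw [hdec]
    simp only [map_add, map_smul, LinearMap.add_apply, LinearMap.map_smulₛₗ, LinearMap.smul_apply,
      h1, hleft _ (hPW x), smul_eq_mul, Complex.normSq_eq_conj_mul_self]
    ring
  rw [hexp, Complex.add_re, Complex.re_ofReal_mul, mul_add]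
  rcases eq_or_ne (P x) 0 with h0 | h0
  · have hc0 : c ≠ 0 := fun hc0 => hx (by rw [hdec, h0, hc0]; simp)
    have := Complex.normSq_pos.mpr hc0
    rw [h0]
    simp only [map_zero, Complex.zero_re, mul_zero, zero_add]
    nlinarith [mul_pos this hvv]
  · nlinarith [key _ (hPW x) h0, mul_nonneg (Complex.normSq_nonneg c) hvv.le]

end Lyapunov

section SpectralSubspace

variable {K V : Type*} [Field K] [AddCommGroup V] [Module K V] [FiniteDimensional K V]

lemma finrank_sup_of_iSupIndep {ι : Type*} [DecidableEq ι] (W : ι → Submodule K V)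
    (hW : iSupIndep W) (t : Finset ι) :
    Module.finrank K (t.sup W : Submodule K V) = ∑ i ∈ t, Module.finrank K (W i) := by
  induction t using Finset.induction_on with
  | empty => simp
  | insert a t ha ih =>
    have hdis : Disjoint (W a) (t.sup W) :=
      (hW.supIndep' (insert a t)) (Finset.subset_insert a t) (Finset.mem_insert_self a t) ha
    have := Submodule.finrank_sup_add_finrank_inf_eq (W a) (t.sup W)
    rw [hdis.eq_bot, finrank_bot, add_zero] at this
    rw [Finset.sup_insert, Finset.sum_insert ha, this, ih]

/-- The sum of the generalized eigenspaces whose eigenvalue satisfies `p`. -/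
noncomputable def spectralSubspace [DecidableEq K] (f : Module.End K V) (p : K → Prop)
    [DecidablePred p] : Submodule K V :=
  (f.charpoly.roots.toFinset.filter p).sup f.maxGenEigenspace

variable [DecidableEq K] (f : Module.End K V) (p : K → Prop) [DecidablePred p]

lemma finrank_spectralSubspace :
    Module.finrank K (spectralSubspace f p) = (f.charpoly.roots.filter p).card := by
  rw [spectralSubspace, finrank_sup_of_iSupIndep _ f.independent_maxGenEigenspace,
    ← Multiset.toFinset_filter, ← Multiset.toFinset_sum_count_eq]
  refine Finset.sum_congr rfl fun μ hμ => ?_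
  rw [LinearMap.finrank_maxGenEigenspace_eq, Multiset.count_filter_of_pos, count_roots]
  simp only [Multiset.mem_toFinset, Multiset.mem_filter] at hμ
  exact hμ.2

lemma apply_mem_spectralSubspace {x : V} (hx : x ∈ spectralSubspace f p) :
    f x ∈ spectralSubspace f p := by
  suffices spectralSubspace f p ≤ (spectralSubspace f p).comap f from this hx
  refine Finset.sup_le fun μ hμ y hy => ?_
  exact Finset.le_sup (f := f.maxGenEigenspace) hμ
    (Module.End.mapsTo_maxGenEigenspace_of_comm (Commute.refl f) μ hy)

lemma eigenvalue_of_mem_spectralSubspace {x : V} (hx : x ∈ spectralSubspace f p) (hx0 : x ≠ 0)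
    {μ : K} (hμ : f x = μ • x) : p μ := by
  by_contra hp
  have hdis : Disjoint (f.maxGenEigenspace μ) (spectralSubspace f p) :=
    (f.independent_maxGenEigenspace.supIndep' (insert μ _)) (Finset.subset_insert μ _)
      (Finset.mem_insert_self μ _) (by simp [hp])
  exact hx0 (Submodule.disjoint_def.mp hdis x
    (Module.End.eigenspace_le_maxGenEigenspace (Module.End.mem_eigenspace_iff.mpr hμ)) hx)

end SpectralSubspace

section Inertia

variable {V : Type*} [AddCommGroup V] [Module ℂ V]

/-- The hypotheses of the inertia theorem: `h` is Hermitian, `Re h(x, f x) > 0` off the kernel of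
`f`, and the kernel of `f` lies in the radical of `h`. -/
structure IsDissipative (h : V →ₗ⋆[ℂ] V →ₗ[ℂ] ℂ) (f : Module.End ℂ V) : Prop where
  hermitian : ∀ x y, star (h x y) = h y x
  re_pos : ∀ x, f x ≠ 0 → 0 < (h x (f x)).re
  radical : ∀ x y, f y = 0 → h x y = 0

variable {h : V →ₗ⋆[ℂ] V →ₗ[ℂ] ℂ} {f g : Module.End ℂ V}

namespace IsDissipative

lemma maxGenEigenspace_le_ker (hf : IsDissipative h f) {μ : ℂ} (hμ : μ.re = 0) :
    f.maxGenEigenspace μ ≤ LinearMap.ker f := by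
  have hker : ∀ x, f x = μ • x → f x = 0 := by
    intro x hx
    by_contra h0
    have h1 := hf.re_pos x h0
    have h2 : (h x x).im = 0 := Complex.conj_eq_iff_im.mp (hf.hermitian x x)
    rw [hx, map_smul, smul_eq_mul, Complex.mul_re, hμ, h2] at h1
    simp at h1
  intro x hx
  obtain ⟨k, hk⟩ := (Module.End.mem_maxGenEigenspace f μ x).mp hx
  rw [LinearMap.mem_ker]
  clear hx
  induction k generalizing x with
  | zero => simp_all
  | succ k ih =>
    rw [pow_succ, Module.End.mul_apply] at hk
    have h1 := ih hk
    simp only [LinearMap.sub_apply, LinearMap.smul_apply, Module.End.one_apply, map_sub,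
      map_smul, sub_eq_zero] at h1
    have h2 : f (f x) = 0 := hker (f x) h1
    by_contra h0
    have := hf.re_pos x h0
    simp [hf.radical x _ h2] at this

variable [FiniteDimensional ℂ V]

lemma definite_spectralSubspace (hf : IsDissipative h f) (s : ℝ) {x : V}
    (hx : x ∈ spectralSubspace f (fun z => 0 < s * z.re)) (hx0 : x ≠ 0) :
    0 < s * (h x x).re := by
  set W := spectralSubspace f (fun z => 0 < s * z.re)
  refine lyapunov_definite s (h.domRestrict₁₂ W W) (fun a b => hf.hermitian a b)
    (f.restrict fun y hy => apply_mem_spectralSubspace f _ hy) ?_ ?_ ⟨x, hx⟩ (by simpa using hx0)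
  · intro a ha
    refine hf.re_pos a fun h0 => ?_
    have := eigenvalue_of_mem_spectralSubspace f _ a.2 (by simpa using ha) (μ := 0) (by simp [h0])
    simp at this
  · intro μ hμ
    obtain ⟨a, ha⟩ := hμ.exists_hasEigenvector
    exact eigenvalue_of_mem_spectralSubspace f _ a.2 (by simpa using ha.2)
      (congrArg Subtype.val ha.apply_eq_smul)

lemma semidefinite_spectralSubspace (hf : IsDissipative h f) {s : ℝ} (hs : s ≠ 0) {x : V}
    (hx : x ∈ spectralSubspace f (fun z => ¬ 0 < s * z.re)) : s * (h x x).re ≤ 0 := by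
  have hle : spectralSubspace f (fun z => ¬ 0 < s * z.re) ≤
      spectralSubspace f (fun z => 0 < -s * z.re) ⊔ LinearMap.ker f := by
    refine Finset.sup_le fun μ hμ => ?_
    rw [Finset.mem_filter] at hμ
    rcases eq_or_ne μ.re 0 with h0 | h0
    · exact (hf.maxGenEigenspace_le_ker h0).trans le_sup_right
    · refine le_trans (Finset.le_sup (f := f.maxGenEigenspace) ?_) le_sup_left
      refine Finset.mem_filter.mpr ⟨hμ.1, ?_⟩
      have := lt_of_le_of_ne (not_lt.mp hμ.2) (mul_ne_zero hs h0)
      linarith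
  obtain ⟨a, ha, k, hk, rfl⟩ := Submodule.mem_sup.mp (hle hx)
  have h1 : ∀ y, h y k = 0 := fun y => hf.radical y k hk
  have h2 : ∀ y, h k y = 0 := fun y => by rw [← hf.hermitian, h1, star_zero]
  simp only [map_add, LinearMap.add_apply, h1, h2, add_zero]
  rcases eq_or_ne a 0 with rfl | h0
  · simp
  · linarith [hf.definite_spectralSubspace (-s) ha h0]

lemma card_roots_le (hf : IsDissipative h f) (hg : IsDissipative h g) {s : ℝ} (hs : s ≠ 0) :
    (f.charpoly.roots.filter fun z => 0 < s * z.re).card ≤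
      (g.charpoly.roots.filter fun z => 0 < s * z.re).card := by
  have hdis : Disjoint (spectralSubspace f (fun z => 0 < s * z.re))
      (spectralSubspace g (fun z => ¬ 0 < s * z.re)) := by
    refine Submodule.disjoint_def.mpr fun x hx hx' => ?_
    by_contra h0
    exact absurd (hf.definite_spectralSubspace s hx h0)
      (not_lt.mpr (hg.semidefinite_spectralSubspace hs hx'))
  have h1 := Submodule.finrank_add_finrank_le_of_disjoint hdis
  rw [finrank_spectralSubspace, finrank_spectralSubspace] at h1
  have h2 := congrArg Multiset.card
    (Multiset.filter_add_not (fun z : ℂ => 0 < s * z.re) g.charpoly.roots)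
  rw [Multiset.card_add, IsAlgClosed.card_roots_eq_natDegree, LinearMap.charpoly_natDegree] at h2
  omega

end IsDissipative

end Inertia

section RealMatrices

variable {n : ℕ}

/-- The sesquilinear form `(x, y) ↦ xᴴ H y` of a complex matrix `H`. -/
noncomputable def sesqForm (H : Matrix (Fin n) (Fin n) ℂ) :
    (Fin n → ℂ) →ₗ⋆[ℂ] (Fin n → ℂ) →ₗ[ℂ] ℂ :=
  LinearMap.mk₂'ₛₗ (starRingEnd ℂ) (RingHom.id ℂ) (fun x y => star x ⬝ᵥ (H *ᵥ y))
    (fun x y z => by rw [star_add, add_dotProduct])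
    (fun c x y => by rw [star_smul, smul_dotProduct]; rfl)
    (fun x y z => by rw [mulVec_add, dotProduct_add])
    (fun c x y => by rw [mulVec_smul, dotProduct_smul]; rfl)

lemma sesqForm_apply (H : Matrix (Fin n) (Fin n) ℂ) (x y : Fin n → ℂ) :
    sesqForm H x y = star x ⬝ᵥ (H *ᵥ y) := rfl

lemma star_sesqForm {H : Matrix (Fin n) (Fin n) ℂ} (hH : H.IsHermitian) (x y : Fin n → ℂ) :
    star (sesqForm H x y) = sesqForm H y x := by
  rw [sesqForm_apply, sesqForm_apply, star_dotProduct, star_star, star_mulVec, hH.eq,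
    dotProduct_mulVec]

lemma re_star_dotProduct_map_mulVec (P : Matrix (Fin n) (Fin n) ℝ) (z : Fin n → ℂ) :
    (star z ⬝ᵥ (P.map (algebraMap ℝ ℂ) *ᵥ z)).re =
      (fun i => (z i).re) ⬝ᵥ (P *ᵥ fun i => (z i).re) +
      (fun i => (z i).im) ⬝ᵥ (P *ᵥ fun i => (z i).im) := by
  simp [dotProduct, mulVec, ← Finset.sum_add_distrib]

lemma isDissipative_toLin' {H P M : Matrix (Fin n) (Fin n) ℝ} (hH : H.IsSymm)
    (hP : ∀ v, v ≠ 0 → 0 < v ⬝ᵥ (P *ᵥ v)) (hM : P * M = H) :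
    IsDissipative (sesqForm (H.map (algebraMap ℝ ℂ)))
      (Matrix.toLin' (M.map (algebraMap ℝ ℂ))) := by
  have hherm : (H.map (algebraMap ℝ ℂ)).IsHermitian := by
    ext i j
    simp [hH.apply]
  have hmul : ∀ x, H.map (algebraMap ℝ ℂ) *ᵥ x =
      P.map (algebraMap ℝ ℂ) *ᵥ Matrix.toLin' (M.map (algebraMap ℝ ℂ)) x := fun x => by
    rw [Matrix.toLin'_apply, mulVec_mulVec, ← Matrix.map_mul, hM]
  have hP0 : ∀ v, 0 ≤ v ⬝ᵥ (P *ᵥ v) := fun v => by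
    rcases eq_or_ne v 0 with rfl | hv
    · simp
    · exact (hP v hv).le
  refine ⟨star_sesqForm hherm, fun x hx => ?_, fun x y hy => ?_⟩
  · rw [← star_sesqForm hherm, sesqForm_apply, hmul]
    set y := Matrix.toLin' (M.map (algebraMap ℝ ℂ)) x
    change 0 < (starRingEnd ℂ _).re
    rw [Complex.conj_re, re_star_dotProduct_map_mulVec]
    by_cases h0 : (fun i => (y i).re) = 0
    · refine add_pos_of_nonneg_of_pos (hP0 _) (hP _ fun h1 => hx ?_)
      ext i
      exact Complex.ext (congrFun h0 i) (congrFun h1 i)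
    · exact add_pos_of_pos_of_nonneg (hP _ h0) (hP0 _)
  · rw [sesqForm_apply, hmul, hy, mulVec_zero, dotProduct_zero]

lemma eigCount_eq_card_roots_toLin' (M : Matrix (Fin n) (Fin n) ℝ) (p : ℝ → Prop)
    [DecidablePred p] (q : ℂ → Prop) [DecidablePred q] (hpq : ∀ z, p z.re ↔ q z) :
    eigCount M p =
      ((Matrix.toLin' (M.map (algebraMap ℝ ℂ))).charpoly.roots.filter q).card := by
  rw [eigCount, Matrix.charpoly_toLin', Matrix.charpoly_map]
  exact congrArg _ (Multiset.filter_congr fun z _ => hpq z)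

end RealMatrices

/-- Lemma 1.4, after Gisclon. Let `S` be symmetric positive definite,
`S * A` symmetric, let the characteristic polynomial of `A` have `n` distinct real roots,
and let `B` satisfy the dissipativity condition `vᵀ S B v ≥ α ‖v‖²` for some `α > 0`.
Then `B` is invertible and `A` and `B⁻¹ * A` have the same number of eigenvalues (over `ℂ`,
counted with multiplicity) with strictly positive real part, as well as the same number of
eigenvalues with strictly negative real part. -/
theorem eig_count_eq_of_dissipative (n : ℕ) (hn : 1 ≤ n)
    (A B S : Matrix (Fin n) (Fin n) ℝ)
    (hS : S.PosDef)
    (hSA : (S * A).IsSymm)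
    (hA : ∃ μ : Fin n → ℝ, Function.Injective μ ∧
      A.charpoly = ∏ i : Fin n, (X - C (μ i)))
    (α : ℝ) (hα : 0 < α)
    (hdiss : ∀ v : Fin n → ℝ, α * (v ⬝ᵥ v) ≤ v ⬝ᵥ ((S * B) *ᵥ v)) :
    IsUnit B.det ∧
    eigCount A (fun x => 0 < x) = eigCount (B⁻¹ * A) (fun x => 0 < x) ∧
    eigCount A (fun x => x < 0) = eigCount (B⁻¹ * A) (fun x => x < 0) := by
  have hSB : ∀ v, v ≠ 0 → 0 < v ⬝ᵥ ((S * B) *ᵥ v) := fun v hv =>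
    (mul_pos hα (by simpa using dotProduct_star_self_pos_iff.mpr hv)).trans_le (hdiss v)
  have hB : IsUnit B.det := by
    rw [isUnit_iff_ne_zero]
    intro h0
    obtain ⟨v, hv, hv0⟩ := Matrix.exists_mulVec_eq_zero_iff.mpr h0
    have := hSB v hv
    rw [← mulVec_mulVec, hv0, mulVec_zero, dotProduct_zero] at this
    exact this.false
  have hdA := isDissipative_toLin' hSA (P := S) (M := A)
    (fun v hv => by simpa using hS.dotProduct_mulVec_pos hv) rfl
  have hdB := isDissipative_toLin' hSA (P := S * B) (M := B⁻¹ * A) hSB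
    (by rw [Matrix.mul_assoc, Matrix.mul_nonsing_inv_cancel_left B A hB])
  have hcount : ∀ (s : ℝ), s ≠ 0 → ∀ (p : ℝ → Prop) [DecidablePred p],
      (∀ x, p x ↔ 0 < s * x) → eigCount A p = eigCount (B⁻¹ * A) p := by
    intro s hs p _ hp
    rw [eigCount_eq_card_roots_toLin' A p _ fun z => hp z.re,
      eigCount_eq_card_roots_toLin' (B⁻¹ * A) p _ fun z => hp z.re]
    exact le_antisymm (hdA.card_roots_le hdB hs) (hdB.card_roots_le hdA hs)
  exact ⟨hB, hcount 1 one_ne_zero _ (by simp), hcount (-1) (by simp) _ (by simp)⟩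
end

section
/- Let n ≥ 1, let F : ℝⁿ → ℝⁿ be continuously differentiable, and let V : (0,∞) → ℝⁿ be a bounded function of bounded total variation such that U(t,x) := V(x/t) is a distributional solution of ∂ₜU + ∂ₓF(U) = 0 on (0,∞) × (0,∞). Let ξ₀ > 0 and let V(ξ₀+) and V(ξ₀−) denote the right and left limits of V at ξ₀ (which exist and are finite because V has bounded variation; assume these limits exist as a hypothesis). Then the Rankine–Hugoniot conditions hold at ξ₀: F(V(ξ₀+)) − F(V(ξ₀−)) = ξ₀ · (V(ξ₀+) − V(ξ₀−)). -/
open Matrix MeasureTheory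

/-- `U(t,x) := V(x/t)` is a self-similar distributional solution of
`∂ₜU + ∂ₓF(U) = 0` on `(0,∞) × (0,∞)`: for every smooth test function `φ` compactly
supported in the open quadrant,
`∬ (U · ∂ₜφ + F(U) · ∂ₓφ) dt dx = 0` (the first coordinate of `p : ℝ × ℝ` is `t`,
the second is `x`). -/
def IsSelfSimilarSolution (n : ℕ) (F : (Fin n → ℝ) → (Fin n → ℝ))
    (V : ℝ → Fin n → ℝ) : Prop :=
  ∀ φ : ℝ × ℝ → Fin n → ℝ, ContDiff ℝ (⊤ : ℕ∞) φ → HasCompactSupport φ →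
    tsupport φ ⊆ Set.Ioi (0 : ℝ) ×ˢ Set.Ioi (0 : ℝ) →
    ∫ p : ℝ × ℝ,
      ((V (p.2 / p.1)) ⬝ᵥ (fderiv ℝ φ p (1, 0)) +
        (F (V (p.2 / p.1))) ⬝ᵥ (fderiv ℝ φ p (0, 1))) = 0

open Set Filter Topology

theorem BoundedVariationOn.measurable_indicator_Ioi {f : ℝ → ℝ} {a : ℝ}
    (hf : BoundedVariationOn f (Ioi a)) : Measurable ((Ioi a).indicator f) := by
  obtain ⟨p, q, hp, hq, rfl⟩ :=
    hf.locallyBoundedVariationOn.exists_monotoneOn_sub_monotoneOn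
  have hmono {r : ℝ → ℝ} (hr : MonotoneOn r (Ioi a)) : Measurable ((Ioi a).indicator r) := by
    refine measurable_of_restrict_of_restrict_compl (s := Ioi a) measurableSet_Ioi ?_ ?_
    · have hm : Measurable (fun x : Ioi a => r x) :=
        Monotone.measurable fun x y hxy => hr x.2 y.2 hxy
      convert! hm using 1
      ext x
      exact indicator_of_mem x.2 r
    · convert! (measurable_const : Measurable fun _ : ((Ioi a)ᶜ : Set ℝ) => (0 : ℝ)) using 1
      ext x
      exact indicator_of_notMem x.2 r
  rw [indicator_sub']
  exact (hmono hp).sub (hmono hq)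

/-- The linear coordinate change `(t, y) ↦ (t, c t + ε y)`. -/
noncomputable def shearScale (c ε : ℝ) (hε : ε ≠ 0) : (ℝ × ℝ) ≃L[ℝ] (ℝ × ℝ) :=
  LinearEquiv.toContinuousLinearEquiv
    { toFun := fun q => (q.1, c * q.1 + ε * q.2)
      invFun := fun p => (p.1, (p.2 - c * p.1) / ε)
      map_add' := fun p q => by ext <;> simp; ring
      map_smul' := fun r p => by ext <;> simp; ring
      left_inv := fun q => by ext <;> simp; field_simp
      right_inv := fun p => by ext <;> simp; field_simp; ring }

theorem integral_comp_continuousLinearEquiv_eq_zero {E G : Type*} [NormedAddCommGroup E]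
    [NormedSpace ℝ E] [FiniteDimensional ℝ E] [MeasurableSpace E] [BorelSpace E]
    [NormedAddCommGroup G] [NormedSpace ℝ G]
    (μ : Measure E) [μ.IsAddHaarMeasure] (L : E ≃L[ℝ] E) {f : E → G}
    (hf : ∫ x, f x ∂μ = 0) : ∫ x, f (L x) ∂μ = 0 := by
  have hL : MeasurableEmbedding L := L.toHomeomorph.measurableEmbedding
  have : (μ.map L).IsAddHaarMeasure := L.isAddHaarMeasure_map μ
  rw [← hL.integral_map, Measure.isAddLeftInvariant_eq_smul (μ.map L) μ,
    integral_smul_nnreal_measure, hf, smul_zero]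

theorem add_mul_div_pos_of_mem {ξ₀ ε t y : ℝ} (hε : 0 < ε) (hεξ : ε < ξ₀) (ht : 1 ≤ t)
    (hy : y ∈ Icc (-1 : ℝ) 1) : 0 < ξ₀ + ε * (y / t) := by
  have h : -1 ≤ y / t := by
    rw [le_div_iff₀ (by linarith)]
    linarith [hy.1]
  nlinarith

theorem hasFDerivAt_shear_mul {χ ψ : ℝ → ℝ} (hχ : Differentiable ℝ χ) (hψ : Differentiable ℝ ψ)
    (c ε : ℝ) (p : ℝ × ℝ) :
    HasFDerivAt (fun p : ℝ × ℝ => χ p.1 * ψ ((p.2 - c * p.1) / ε))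
      (χ p.1 • (deriv ψ ((p.2 - c * p.1) / ε) •
          (ε⁻¹ • (ContinuousLinearMap.snd ℝ ℝ ℝ - c • ContinuousLinearMap.fst ℝ ℝ ℝ))) +
        ψ ((p.2 - c * p.1) / ε) • (deriv χ p.1 • ContinuousLinearMap.fst ℝ ℝ ℝ)) p := by
  have h₁ : HasFDerivAt (fun p : ℝ × ℝ => χ p.1) (deriv χ p.1 • ContinuousLinearMap.fst ℝ ℝ ℝ) p :=
    (hχ p.1).hasDerivAt.comp_hasFDerivAt p hasFDerivAt_fst
  have h₂ : HasFDerivAt (fun p : ℝ × ℝ => (p.2 - c * p.1) / ε)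
      (ε⁻¹ • (ContinuousLinearMap.snd ℝ ℝ ℝ - c • ContinuousLinearMap.fst ℝ ℝ ℝ)) p := by
    simp only [div_eq_inv_mul]
    exact (hasFDerivAt_snd.sub (hasFDerivAt_fst.const_mul c)).const_mul ε⁻¹
  exact h₁.mul ((hψ _).hasDerivAt.comp_hasFDerivAt p h₂)

/-- The weak formulation tested against `χ(t) ψ((x - ξ₀ t) / ε)`, in the coordinates
`x = ξ₀ t + ε y`. -/
theorem IsSelfSimilarSolution.integral_rescaled_eq_zero {n : ℕ} {F : (Fin n → ℝ) → Fin n → ℝ}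
    {V : ℝ → Fin n → ℝ} (hsol : IsSelfSimilarSolution n F V) {χ ψ : ℝ → ℝ}
    (hχ : ContDiff ℝ (⊤ : ℕ∞) χ) (hψ : ContDiff ℝ (⊤ : ℕ∞) ψ) (hχc : HasCompactSupport χ)
    (hψc : HasCompactSupport ψ) (hχs : tsupport χ ⊆ Ici 1) (hψs : tsupport ψ ⊆ Icc (-1) 1)
    {ξ₀ ε : ℝ} (hε : 0 < ε) (hεξ : ε < ξ₀) (i : Fin n) :
    ∫ q : ℝ × ℝ, (ε * (V (ξ₀ + ε * (q.2 / q.1)) i * (deriv χ q.1 * ψ q.2)) +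
      (F (V (ξ₀ + ε * (q.2 / q.1))) i - ξ₀ * V (ξ₀ + ε * (q.2 / q.1)) i) *
        (χ q.1 * deriv ψ q.2)) = 0 := by
  set φ : ℝ × ℝ → Fin n → ℝ := fun p =>
    (χ p.1 * ψ ((p.2 - ξ₀ * p.1) / ε)) • Pi.single i 1 with hφ
  set L := shearScale ξ₀ ε hε.ne'
  set K : Set (ℝ × ℝ) := L '' (tsupport χ ×ˢ tsupport ψ)
  have hK : IsCompact K := (hχc.isCompact.prod hψc.isCompact).image L.continuous
  have hφK : ∀ p ∉ K, φ p = 0 := by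
    intro p hp
    by_contra hne
    refine hp ⟨L.symm p, ⟨subset_tsupport _ ?_, subset_tsupport _ ?_⟩, L.apply_symm_apply p⟩
    · intro h
      have h' : χ p.1 = 0 := h
      exact hne (by simp [hφ, h'])
    · intro h
      have h' : ψ ((p.2 - ξ₀ * p.1) / ε) = 0 := h
      exact hne (by simp [hφ, h'])
  have hKpos : K ⊆ Ioi (0 : ℝ) ×ˢ Ioi (0 : ℝ) := by
    rintro _ ⟨q, ⟨hq₁, hq₂⟩, rfl⟩
    have ht : 1 ≤ q.1 := hχs hq₁
    have hy := hψs hq₂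
    refine ⟨show 0 < q.1 by linarith, show 0 < ξ₀ * q.1 + ε * q.2 from ?_⟩
    nlinarith [hy.1]
  have hφsm : ContDiff ℝ (⊤ : ℕ∞) φ := by
    refine ContDiff.smul (ContDiff.mul (hχ.comp contDiff_fst) (hψ.comp ?_)) contDiff_const
    fun_prop
  have hts : tsupport φ ⊆ K :=
    closure_minimal (fun p hp => by_contra fun h => hp (hφK p h)) hK.isClosed
  have hint := integral_comp_continuousLinearEquiv_eq_zero volume L
    (hsol φ hφsm (HasCompactSupport.intro hK hφK) (hts.trans hKpos))
  have hder (p v : ℝ × ℝ) : fderiv ℝ φ p v =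
      (χ p.1 * (deriv ψ ((p.2 - ξ₀ * p.1) / ε) * (ε⁻¹ * (v.2 - ξ₀ * v.1))) +
        ψ ((p.2 - ξ₀ * p.1) / ε) * (deriv χ p.1 * v.1)) • Pi.single i 1 := by
    rw [((hasFDerivAt_shear_mul (hχ.differentiable (by simp)) (hψ.differentiable (by simp))
      ξ₀ ε p).smul_const (Pi.single i (1 : ℝ) : Fin n → ℝ)).fderiv]
    simp
  have hmul := congrArg (ε * ·) hint
  simp only [mul_zero, ← integral_const_mul] at hmul
  rw [← hmul]
  refine integral_congr_ae (Eventually.of_forall fun q => ?_)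
  have hL₁ : (L q).1 = q.1 := rfl
  have hL₂ : (L q).2 = ξ₀ * q.1 + ε * q.2 := rfl
  have hy : (ξ₀ * q.1 + ε * q.2 - ξ₀ * q.1) / ε = q.2 := by field_simp; ring
  simp only [hder, hL₁, hL₂, hy, dotProduct_smul, dotProduct_single, smul_eq_mul]
  by_cases ht : q.1 ∈ tsupport χ
  · have ht₁ : 1 ≤ q.1 := hχs ht
    have hx : (ξ₀ * q.1 + ε * q.2) / q.1 = ξ₀ + ε * (q.2 / q.1) := by field_simp
    rw [hx]
    field_simp
    ring
  · have h₁ : χ q.1 = 0 := image_eq_zero_of_notMem_tsupport ht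
    have h₂ : deriv χ q.1 = 0 := by_contra fun h => ht (support_deriv_subset h)
    simp [h₁, h₂]

theorem tendsto_add_mul_nhdsGT {ξ₀ r : ℝ} (hr : 0 < r) :
    Tendsto (fun ε => ξ₀ + ε * r) (𝓝[>] 0) (𝓝[>] ξ₀) := by
  refine tendsto_nhdsWithin_iff.2 ⟨tendsto_nhdsWithin_of_tendsto_nhds ?_, ?_⟩
  · exact Continuous.tendsto' (by fun_prop) _ _ (by simp)
  · filter_upwards [self_mem_nhdsWithin] with ε (hε : 0 < ε)
    exact lt_add_of_pos_right _ (mul_pos hε hr)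

theorem tendsto_add_mul_nhdsLT {ξ₀ r : ℝ} (hr : r < 0) :
    Tendsto (fun ε => ξ₀ + ε * r) (𝓝[>] 0) (𝓝[<] ξ₀) := by
  refine tendsto_nhdsWithin_iff.2 ⟨tendsto_nhdsWithin_of_tendsto_nhds ?_, ?_⟩
  · exact Continuous.tendsto' (by fun_prop) _ _ (by simp)
  · filter_upwards [self_mem_nhdsWithin] with ε (hε : 0 < ε)
    exact add_lt_of_neg_right _ (mul_neg_of_pos_of_neg hε hr)

theorem tendsto_integral_rescaled {a g χ ψ : ℝ → ℝ} {C ξ₀ gp gm : ℝ}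
    (ha : Measurable a) (hg : Measurable g) (haC : ∀ x, |a x| ≤ C) (hgC : ∀ x, |g x| ≤ C)
    (hgp : Tendsto g (𝓝[>] ξ₀) (𝓝 gp)) (hgm : Tendsto g (𝓝[<] ξ₀) (𝓝 gm))
    (hχ : ContDiff ℝ 1 χ) (hψ : ContDiff ℝ 1 ψ) (hχc : HasCompactSupport χ)
    (hψc : HasCompactSupport ψ) (hχs : tsupport χ ⊆ Ici 1) :
    Tendsto (fun ε => ∫ q : ℝ × ℝ,
      (ε * (a (ξ₀ + ε * (q.2 / q.1)) * (deriv χ q.1 * ψ q.2)) +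
        g (ξ₀ + ε * (q.2 / q.1)) * (χ q.1 * deriv ψ q.2))) (𝓝[>] 0)
      (𝓝 (∫ q : ℝ × ℝ, χ q.1 * ((if 0 < q.2 then gp else gm) * deriv ψ q.2))) := by
  have hχ' := hχ.continuous_deriv le_rfl
  have hψ' := hψ.continuous_deriv le_rfl
  refine tendsto_integral_filter_of_dominated_convergence
    (fun q => C * ‖deriv χ q.1 * ψ q.2‖ + C * ‖χ q.1 * deriv ψ q.2‖) ?_ ?_ ?_ ?_
  · refine Eventually.of_forall fun ε => Measurable.aestronglyMeasurable ?_
    have := hχ.continuous.measurable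
    have := hψ.continuous.measurable
    have := hχ'.measurable
    have := hψ'.measurable
    fun_prop
  · filter_upwards [Ioo_mem_nhdsGT (zero_lt_one' ℝ)] with ε hε
    refine Eventually.of_forall fun q => (norm_add_le _ _).trans (add_le_add ?_ ?_)
    · rw [norm_mul, norm_mul]
      have h₁ : ‖ε‖ ≤ 1 := by rw [Real.norm_of_nonneg hε.1.le]; exact hε.2.le
      calc _ ≤ 1 * (C * ‖deriv χ q.1 * ψ q.2‖) := by gcongr; exact haC _
        _ = _ := one_mul _
    · rw [norm_mul]
      gcongr
      exact hgC _
  · exact (((hχ'.integrable_of_hasCompactSupport hχc.deriv).mul_prod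
      (hψ.continuous.integrable_of_hasCompactSupport hψc)).norm.const_mul C).add
      (((hχ.continuous.integrable_of_hasCompactSupport hχc).mul_prod
      (hψ'.integrable_of_hasCompactSupport hψc.deriv)).norm.const_mul C)
  · have hne : ∀ᵐ q : ℝ × ℝ, q.2 ≠ 0 :=
      Measure.quasiMeasurePreserving_snd.ae (Measure.ae_ne volume (0 : ℝ))
    filter_upwards [hne] with q hq
    by_cases ht : q.1 ∈ tsupport χ
    · have ht₀ : 0 < q.1 := zero_lt_one.trans_le (hχs ht)
      have h₁ : Tendsto (fun ε : ℝ => ε * (a (ξ₀ + ε * (q.2 / q.1)) * (deriv χ q.1 * ψ q.2)))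
          (𝓝[>] 0) (𝓝 0) := by
        refine Tendsto.zero_mul_isBoundedUnder_le
          (tendsto_nhdsWithin_of_tendsto_nhds tendsto_id) ?_
        refine isBoundedUnder_of ⟨C * ‖deriv χ q.1 * ψ q.2‖, fun ε => ?_⟩
        rw [Function.comp_apply, norm_mul]
        gcongr
        exact haC _
      have h₂ : Tendsto (fun ε : ℝ => g (ξ₀ + ε * (q.2 / q.1))) (𝓝[>] 0)
          (𝓝 (if 0 < q.2 then gp else gm)) := by
        split_ifs with hy
        · exact hgp.comp (tendsto_add_mul_nhdsGT (div_pos hy ht₀))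
        · exact hgm.comp (tendsto_add_mul_nhdsLT
            (div_neg_of_neg_of_pos (lt_of_le_of_ne (not_lt.1 hy) hq) ht₀))
      convert! h₁.add (h₂.mul_const (χ q.1 * deriv ψ q.2)) using 2
      ring
    · have h₁ : χ q.1 = 0 := image_eq_zero_of_notMem_tsupport ht
      have h₂ : deriv χ q.1 = 0 := by_contra fun h => ht (support_deriv_subset h)
      simp [h₁, h₂]

theorem integral_step_mul_deriv {ψ : ℝ → ℝ} (hψ : ContDiff ℝ 1 ψ) (hψc : HasCompactSupport ψ)
    (gp gm : ℝ) :
    ∫ y, (if 0 < y then gp else gm) * deriv ψ y = (gm - gp) * ψ 0 := by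
  have hint : Integrable (deriv ψ) :=
    (hψ.continuous_deriv le_rfl).integrable_of_hasCompactSupport hψc.deriv
  have hp : ∀ y ∈ Ioi (0 : ℝ), (if 0 < y then gp else gm) * deriv ψ y = gp * deriv ψ y :=
    fun y hy => by rw [if_pos (mem_Ioi.1 hy)]
  have hm : ∀ y ∈ Iic (0 : ℝ), (if 0 < y then gp else gm) * deriv ψ y = gm * deriv ψ y :=
    fun y hy => by rw [if_neg (not_lt.2 hy)]
  rw [← intervalIntegral.integral_Iic_add_Ioi (b := 0)
      ((hint.const_mul gm).integrableOn.congr_fun (fun y hy => (hm y hy).symm) measurableSet_Iic)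
      ((hint.const_mul gp).integrableOn.congr_fun (fun y hy => (hp y hy).symm) measurableSet_Ioi),
    setIntegral_congr_fun measurableSet_Iic hm, setIntegral_congr_fun measurableSet_Ioi hp,
    integral_const_mul, integral_const_mul, hψc.integral_Iic_deriv_eq hψ,
    hψc.integral_Ioi_deriv_eq hψ]
  ring

/-- Rankine–Hugoniot conditions, part (2) of Lemma 2.1. If
`U(t,x) = V(x/t)` is a bounded self-similar distributional solution with `V` of bounded
variation on `(0,∞)`, and the one-sided limits `V(ξ₀+)`, `V(ξ₀−)` exist at `ξ₀ > 0`, then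
`F(V(ξ₀+)) − F(V(ξ₀−)) = ξ₀ • (V(ξ₀+) − V(ξ₀−))`. -/
theorem rankine_hugoniot (n : ℕ) (hn : 1 ≤ n)
    (F : (Fin n → ℝ) → (Fin n → ℝ)) (hF : ContDiff ℝ 1 F)
    (V : ℝ → Fin n → ℝ)
    (hbd : ∃ M : ℝ, ∀ ξ, 0 < ξ → ‖V ξ‖ ≤ M)
    (hBV : BoundedVariationOn V (Set.Ioi 0))
    (hsol : IsSelfSimilarSolution n F V)
    (ξ₀ : ℝ) (hξ₀ : 0 < ξ₀) (Vp Vm : Fin n → ℝ)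
    (hVp : Filter.Tendsto V (nhdsWithin ξ₀ (Set.Ioi ξ₀)) (nhds Vp))
    (hVm : Filter.Tendsto V (nhdsWithin ξ₀ (Set.Iio ξ₀)) (nhds Vm)) :
    F Vp - F Vm = ξ₀ • (Vp - Vm) := by
  obtain ⟨M, hM⟩ := hbd
  funext i
  set W : ℝ → Fin n → ℝ := (Ioi 0).indicator V with hW
  have hWV {x : ℝ} (hx : 0 < x) : W x = V x := indicator_of_mem hx V
  have hWm : Measurable W := by
    refine measurable_pi_iff.2 fun j => ?_
    have hj : BoundedVariationOn (fun x => V x j) (Ioi 0) :=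
      (LipschitzWith.eval j).comp_boundedVariationOn hBV
    convert! hj.measurable_indicator_Ioi using 1
    ext x
    by_cases hx : x ∈ Ioi (0 : ℝ) <;> simp [hW, hx]
  have hWM (x : ℝ) : W x ∈ Metric.closedBall 0 |M| := by
    rw [mem_closedBall_zero_iff]
    by_cases hx : 0 < x
    · rw [hWV hx]
      exact (hM x hx).trans (le_abs_self M)
    · rw [hW, indicator_of_notMem (by simpa using hx)]
      simp
  have hGc : Continuous fun v : Fin n → ℝ => F v i - ξ₀ * v i := by
    have := hF.continuous
    fun_prop
  obtain ⟨C₁, hC₁⟩ := (isCompact_closedBall (0 : Fin n → ℝ) |M|).exists_bound_of_continuousOn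
    hGc.continuousOn
  obtain ⟨C₂, hC₂⟩ := (isCompact_closedBall (0 : Fin n → ℝ) |M|).exists_bound_of_continuousOn
    (continuous_apply i).continuousOn
  have hWp : Tendsto W (𝓝[>] ξ₀) (𝓝 Vp) := hVp.congr' <| by
    filter_upwards [self_mem_nhdsWithin] with x hx
    exact (hWV (hξ₀.trans hx)).symm
  have hWn : Tendsto W (𝓝[<] ξ₀) (𝓝 Vm) := hVm.congr' <| by
    filter_upwards [Ioo_mem_nhdsLT hξ₀] with x hx
    exact (hWV hx.1).symm
  let χ : ContDiffBump (3 : ℝ) := ⟨1, 2, one_pos, one_lt_two⟩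
  let ψ : ContDiffBump (0 : ℝ) := ⟨1 / 2, 1, by norm_num, by norm_num⟩
  have hχs : tsupport χ ⊆ Ici 1 := by
    rw [χ.tsupport_eq, Real.closedBall_eq_Icc]
    exact fun x hx => le_trans (by norm_num [χ]) hx.1
  have hψs : tsupport ψ ⊆ Icc (-1) 1 := by
    rw [ψ.tsupport_eq, Real.closedBall_eq_Icc]
    simp [ψ]
  have hlim := tendsto_integral_rescaled (a := fun x => W x i) (C := max C₂ C₁)
    ((measurable_pi_apply i).comp hWm) (hGc.measurable.comp hWm)
    (fun x => (hC₂ _ (hWM x)).trans (le_max_left _ _))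
    (fun x => (hC₁ _ (hWM x)).trans (le_max_right _ _))
    ((hGc.tendsto Vp).comp hWp) ((hGc.tendsto Vm).comp hWn)
    χ.contDiff ψ.contDiff χ.hasCompactSupport ψ.hasCompactSupport hχs
  have hzero := hlim.congr' (f₂ := fun _ => (0 : ℝ)) <| by
    filter_upwards [Ioo_mem_nhdsGT hξ₀] with ε hε
    refine Eq.trans ?_ (hsol.integral_rescaled_eq_zero χ.contDiff ψ.contDiff
      χ.hasCompactSupport ψ.hasCompactSupport hχs hψs hε.1 hε.2 i)
    refine integral_congr_ae (Eventually.of_forall fun q => ?_)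
    by_cases ht : q.1 ∈ tsupport χ
    · by_cases hy : q.2 ∈ tsupport ψ
      · simp only [Function.comp_apply, hWV (add_mul_div_pos_of_mem hε.1 hε.2 (hχs ht) (hψs hy))]
      · have h₁ : ψ q.2 = 0 := image_eq_zero_of_notMem_tsupport hy
        have h₂ : deriv ψ q.2 = 0 := by_contra fun h => hy (support_deriv_subset h)
        simp [h₁, h₂]
    · have h₁ : χ q.1 = 0 := image_eq_zero_of_notMem_tsupport ht
      have h₂ : deriv χ q.1 = 0 := by_contra fun h => ht (support_deriv_subset h)
      simp [h₁, h₂]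
  have hprod := tendsto_nhds_unique hzero tendsto_const_nhds
  rw [Measure.volume_eq_prod, integral_prod_mul χ
    (fun y => (if 0 < y then F Vp i - ξ₀ * Vp i else F Vm i - ξ₀ * Vm i) * deriv ψ y),
    integral_step_mul_deriv ψ.contDiff ψ.hasCompactSupport,
    ψ.one_of_mem_closedBall (Metric.mem_closedBall_self (by norm_num [ψ])), mul_one] at hprod
  have hjump := (mul_eq_zero.1 hprod).resolve_left (χ.integral_pos (μ := volume)).ne'
  simp only [Pi.sub_apply, Pi.smul_apply, smul_eq_mul]
  linarith
end

section
/- Let n ≥ 1, let F : ℝⁿ → ℝⁿ be continuously differentiable, and let V : (0,∞) → ℝⁿ be a bounded function of bounded total variation such that U(t,x) := V(x/t) is a distributional solution of ∂ₜU + ∂ₓF(U) = 0 on (0,∞) × (0,∞). Let ξ₀ > 0 be a point at which V is continuous and such that V is not almost everywhere constant on any open neighborhood of ξ₀ (i.e., ξ₀ belongs to the support of the distributional derivative of V). Then ξ₀ is an eigenvalue of the Jacobian matrix DF(V(ξ₀)); that is, det(DF(V(ξ₀)) − ξ₀·I) = 0. -/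
open Matrix MeasureTheory

/-- The Jacobian matrix of `F : ℝⁿ → ℝⁿ` at `U`: the `(i, j)` entry is `∂ⱼ Fᵢ (U)`. -/
noncomputable def jacobianMatrix {n : ℕ} (F : (Fin n → ℝ) → (Fin n → ℝ))
    (U : Fin n → ℝ) : Matrix (Fin n) (Fin n) ℝ :=
  Matrix.of fun i j => fderiv ℝ F U (Pi.single j 1) i

open Set
open scoped ContDiff

/-- A function of bounded variation on `(0, ∞)`, extended by zero, is measurable. -/
theorem measurable_indicator_of_boundedVariationOn_Ioi {n : ℕ} {V : ℝ → Fin n → ℝ}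
    (hV : BoundedVariationOn V (Ioi 0)) : Measurable ((Ioi (0 : ℝ)).indicator V) := by
  have hexp : BoundedVariationOn (V ∘ Real.exp) univ :=
    ((eVariationOn.comp_le_of_monotoneOn V Real.exp (Real.exp_monotone.monotoneOn univ)
      fun x _ => Real.exp_pos x).trans_lt hV.lt_top).ne
  have hmeas : Measurable (V ∘ Real.exp) := by
    refine measurable_pi_iff.2 fun i => ?_
    have hi : LocallyBoundedVariationOn (fun x => V (Real.exp x) i) univ :=
      (LipschitzWith.eval i).comp_locallyBoundedVariationOn hexp.locallyBoundedVariationOn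
    obtain ⟨p, q, hp, hq, hpq⟩ := hi.exists_monotoneOn_sub_monotoneOn
    change Measurable (fun x => V (Real.exp x) i)
    rw [hpq]
    exact (monotoneOn_univ.1 hp).measurable.sub (monotoneOn_univ.1 hq).measurable
  have heq : (Ioi (0 : ℝ)).indicator V =
      (Ioi (0 : ℝ)).indicator ((V ∘ Real.exp) ∘ Real.log) := by
    refine indicator_congr fun x hx => ?_
    simp [Real.exp_log (mem_Ioi.1 hx)]
  rw [heq]
  exact (hmeas.comp Real.measurable_log).indicator measurableSet_Ioi

/-- A compactly supported function with support in `(0, ∞)` vanishes outside some `[a, b]` with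
`0 < a < b`. -/
theorem exists_tsupport_subset_Ioo {ψ : ℝ → ℝ} (hc : HasCompactSupport ψ)
    (hs : tsupport ψ ⊆ Ioi 0) : ∃ a b : ℝ, 0 < a ∧ a < b ∧ tsupport ψ ⊆ Ioo a b := by
  rcases (tsupport ψ).eq_empty_or_nonempty with h | h
  · exact ⟨1, 2, by norm_num, by norm_num, by simp [h]⟩
  · obtain ⟨a, ha, ha'⟩ := hc.exists_isLeast h
    obtain ⟨b, hb, hb'⟩ := hc.exists_isGreatest h
    have h0 : 0 < a := hs ha
    refine ⟨a / 2, b + 1, by linarith, by linarith [ha' hb], fun x hx => ⟨?_, ?_⟩⟩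
    · linarith [ha' hx]
    · linarith [hb' hx]

/-- **Integration by parts** between a test function and the primitive of a locally integrable
function. -/
theorem integral_primitive_mul_deriv {v ψ : ℝ → ℝ} (hv : LocallyIntegrable v)
    (hψ : ContDiff ℝ ∞ ψ) (hc : HasCompactSupport ψ) (hs : tsupport ψ ⊆ Ioi 0) :
    ∫ x, (∫ s in (0 : ℝ)..x, v s) * deriv ψ x = -∫ x, v x * ψ x := by
  obtain ⟨a, b, ha, hab, hsub⟩ := exists_tsupport_subset_Ioo hc hs
  have hzero : ∀ x ∉ Ioo a b, ψ x = 0 :=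
    fun x hx => image_eq_zero_of_notMem_tsupport (mt (@hsub x) hx)
  have hdzero : ∀ x ∉ Ioo a b, deriv ψ x = 0 := fun x hx =>
    image_eq_zero_of_notMem_tsupport fun h => hx (hsub (tsupport_deriv_subset h))
  have hvi : ∀ x y, IntervalIntegrable v volume x y := fun x y =>
    (hv.integrableOn_isCompact isCompact_uIcc).intervalIntegrable
  have hP : AbsolutelyContinuousOnInterval (fun x => ∫ s in (0 : ℝ)..x, v s) 0 b :=
    (hvi 0 b).absolutelyContinuousOnInterval_intervalIntegral (by simp)
  have hψac : AbsolutelyContinuousOnInterval ψ 0 b :=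
    (hψ.of_le (by norm_num)).contDiffOn.absolutelyContinuousOnInterval
  have hib := hP.integral_mul_deriv_eq_deriv_mul hψac
  have hset : ∀ f : ℝ → ℝ, (∀ x ∉ Ioo a b, f x = 0) → ∫ x, f x = ∫ x in (0 : ℝ)..b, f x := by
    intro f hf
    rw [intervalIntegral.integral_of_le (by linarith)]
    refine (setIntegral_eq_integral_of_forall_compl_eq_zero fun x hx => hf x fun h => hx ?_).symm
    exact ⟨by linarith [h.1], h.2.le⟩
  rw [hset _ fun x hx => by simp [hdzero x hx], hset _ fun x hx => by simp [hzero x hx], hib,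
    hzero b (by simp), hzero 0 (by simp [ha.le])]
  have : ∫ x in (0 : ℝ)..b, deriv (fun x => ∫ s in (0 : ℝ)..x, v s) x * ψ x =
      ∫ x in (0 : ℝ)..b, v x * ψ x := by
    refine intervalIntegral.integral_congr_ae ?_
    filter_upwards [LocallyIntegrable.ae_hasDerivAt_integral hv] with x hx _
    rw [(hx 0).deriv]
  simp [this]

/-- There is a test function on `(0, ∞)` of integral one. -/
theorem exists_contDiff_integral_eq_one : ∃ χ : ℝ → ℝ, ContDiff ℝ ∞ χ ∧ HasCompactSupport χ ∧
    tsupport χ ⊆ Ioi 0 ∧ ∫ x, χ x = 1 := by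
  let B : ContDiffBump (1 : ℝ) := ⟨1 / 4, 1 / 2, by norm_num, by norm_num⟩
  refine ⟨B.normed volume, B.contDiff_normed, B.hasCompactSupport_normed, ?_, B.integral_normed⟩
  rw [B.tsupport_normed_eq, Real.closedBall_eq_Icc]
  intro x hx
  have : (1 : ℝ) - 1 / 2 ≤ x := hx.1
  simp only [mem_Ioi]
  linarith

/-- **du Bois-Reymond lemma** on `(0, ∞)`. -/
theorem ae_eq_const_of_integral_mul_deriv_eq_zero {f : ℝ → ℝ} (hf : LocallyIntegrable f)
    (h : ∀ ψ : ℝ → ℝ, ContDiff ℝ ∞ ψ → HasCompactSupport ψ → tsupport ψ ⊆ Ioi 0 →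
      ∫ x, f x * deriv ψ x = 0) :
    ∃ c : ℝ, ∀ᵐ x, x ∈ Ioi (0 : ℝ) → f x = c := by
  obtain ⟨β, hβs, hβc, hβp, hβi⟩ := exists_contDiff_integral_eq_one
  refine ⟨∫ x, f x * β x, ?_⟩
  have hmul : ∀ g : ℝ → ℝ, ContDiff ℝ ∞ g → HasCompactSupport g →
      Integrable fun x => f x * g x := fun g hg hgc => by
    simpa [mul_comm] using hf.integrable_smul_left_of_hasCompactSupport hg.continuous hgc
  have key := isOpen_Ioi.ae_eq_zero_of_integral_contDiff_smul_eq_zero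
    (f := fun x => f x - ∫ x, f x * β x) (U := Ioi (0 : ℝ)) (μ := volume)
    ((hf.sub (locallyIntegrable_const _)).locallyIntegrableOn _) ?_
  · filter_upwards [key] with x hx hx0 using sub_eq_zero.1 (hx hx0)
  intro θ hθ hθc hθs
  set θ₁ : ℝ → ℝ := fun x => θ x - (∫ y, θ y) * β x with hθ₁
  have hθ₁d : ContDiff ℝ ∞ θ₁ := hθ.sub (contDiff_const.mul hβs)
  have hθ₁c : HasCompactSupport θ₁ := hθc.sub hβc.mul_left
  have hθ₁s : tsupport θ₁ ⊆ Ioi 0 :=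
    (tsupport_sub _ _).trans (union_subset hθs
      ((closure_mono (Function.support_mul_subset_right _ _)).trans hβp))
  obtain ⟨a, b, ha, hab, hsub⟩ := exists_tsupport_subset_Ioo hθ₁c hθ₁s
  have hzero : ∀ x ∉ Ioo a b, θ₁ x = 0 :=
    fun x hx => image_eq_zero_of_notMem_tsupport (mt (@hsub x) hx)
  have hint : ∀ g : ℝ → ℝ, ContDiff ℝ ∞ g → HasCompactSupport g → Integrable g :=
    fun g hg hgc => hg.continuous.integrable_of_hasCompactSupport hgc
  have hθ₁i : ∫ x, θ₁ x = 0 := by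
    rw [hθ₁, integral_sub (hint _ hθ hθc) ((hint _ hβs hβc).const_mul _), integral_const_mul, hβi]
    simp
  set ψ : ℝ → ℝ := fun x => ∫ s in a..x, θ₁ s with hψ
  have hder : ∀ x, HasDerivAt ψ (θ₁ x) x := fun x =>
    intervalIntegral.integral_hasDerivAt_right (hθ₁d.continuous.intervalIntegrable _ _)
      (hθ₁d.continuous.stronglyMeasurableAtFilter _ _) hθ₁d.continuous.continuousAt
  have hderiv : deriv ψ = θ₁ := funext fun x => (hder x).deriv
  have hψd : ContDiff ℝ ∞ ψ := by
    rw [contDiff_infty_iff_deriv]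
    exact ⟨fun x => (hder x).differentiableAt, hderiv ▸ hθ₁d⟩
  have hψz : Function.support ψ ⊆ Icc a b := by
    intro x hx
    by_contra hn
    refine hx ?_
    rcases lt_or_ge x a with hxa | hxa
    · change ∫ s in a..x, θ₁ s = 0
      rw [intervalIntegral.integral_symm, intervalIntegral.integral_of_le hxa.le,
        setIntegral_eq_zero_of_forall_eq_zero, neg_zero]
      exact fun y hy => hzero y fun h => absurd h.1 (not_lt.2 hy.2)
    · have hbx : b < x := lt_of_not_ge fun h => hn ⟨hxa, h⟩
      change ∫ s in a..x, θ₁ s = 0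
      rw [intervalIntegral.integral_of_le hxa, ← hθ₁i]
      exact setIntegral_eq_integral_of_forall_compl_eq_zero fun y hy => hzero y
        fun h => hy ⟨h.1, by linarith [h.2]⟩
  have h0 := h ψ hψd (HasCompactSupport.of_support_subset_isCompact isCompact_Icc hψz)
    ((closure_minimal hψz isClosed_Icc).trans fun x hx => ha.trans_le hx.1)
  rw [hderiv] at h0
  have e1 : ∀ x, f x * θ₁ x = f x * θ x - (∫ y, θ y) * (f x * β x) := fun x => by
    simp only [hθ₁]; ring
  have e2 : ∀ x, θ x • (f x - ∫ x, f x * β x) = f x * θ x - (∫ x, f x * β x) * θ x := fun x => by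
    simp only [smul_eq_mul]; ring
  simp_rw [e1] at h0
  simp_rw [e2]
  rw [integral_sub (hmul _ hθ hθc) ((hmul _ hβs hβc).const_mul _), integral_const_mul] at h0
  rw [integral_sub (hmul _ hθ hθc) ((hint _ hθ hθc).const_mul _), integral_const_mul]
  linarith

/-- Testing `∂ₜ u(x/t) + ∂ₓ g(x/t) = 0` against `χ(t) ψ(x/t)` gives the weak form of
`(g - ξ u)' + u = 0` on `(0, ∞)`. -/
theorem integral_profile_mul_deriv {u g : ℝ → ℝ} {M : ℝ} (hu : Measurable u) (hg : Measurable g)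
    (hub : ∀ ξ, ‖u ξ‖ ≤ M) (hgb : ∀ ξ, ‖g ξ‖ ≤ M)
    (hsol : ∀ Φ : ℝ × ℝ → ℝ, ContDiff ℝ ∞ Φ → HasCompactSupport Φ →
      tsupport Φ ⊆ Ioi (0 : ℝ) ×ˢ Ioi (0 : ℝ) →
      ∫ p : ℝ × ℝ, (u (p.2 / p.1) * fderiv ℝ Φ p (1, 0) +
        g (p.2 / p.1) * fderiv ℝ Φ p (0, 1)) = 0)
    {ψ : ℝ → ℝ} (hψ : ContDiff ℝ ∞ ψ) (hψc : HasCompactSupport ψ) (hψs : tsupport ψ ⊆ Ioi 0) :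
    ∫ ξ, (g ξ - ξ * u ξ) * deriv ψ ξ = ∫ ξ, u ξ * ψ ξ := by
  obtain ⟨χ, hχ, hχc, hχs, hχi⟩ := exists_contDiff_integral_eq_one
  have hχn : ∀ t ≤ 0, t ∉ tsupport χ := fun t ht h => absurd (hχs h) (not_lt.2 ht)
  have hχz : ∀ t ≤ 0, χ t = 0 := fun t ht => image_eq_zero_of_notMem_tsupport (hχn t ht)
  have hχdz : ∀ t ≤ 0, deriv χ t = 0 := fun t ht =>
    image_eq_zero_of_notMem_tsupport fun h => hχn t ht (tsupport_deriv_subset h)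
  set Φ : ℝ × ℝ → ℝ := fun p => χ p.1 * ψ (p.2 / p.1) with hΦ
  have hΦ0 : ∀ p : ℝ × ℝ, p.1 = 0 → Φ =ᶠ[nhds p] fun _ => 0 := by
    intro p hp
    have hev := (notMem_tsupport_iff_eventuallyEq.1 (hχn p.1 hp.le)).comp_tendsto
      (continuous_fst.tendsto p)
    filter_upwards [hev] with q hq
    have : χ q.1 = 0 := hq
    simp [hΦ, this]
  have hΦd : ContDiff ℝ ∞ Φ := by
    refine contDiff_iff_contDiffAt.2 fun p => ?_
    by_cases hp : p.1 = 0
    · exact contDiffAt_const.congr_of_eventuallyEq (hΦ0 p hp)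
    · exact (hχ.contDiffAt.comp p contDiffAt_fst).mul
        (hψ.contDiffAt.comp p (contDiffAt_snd.div contDiffAt_fst hp))
  have hK : IsCompact ((fun q : ℝ × ℝ => (q.1, q.1 * q.2)) '' (tsupport χ ×ˢ tsupport ψ)) :=
    (hχc.isCompact.prod hψc.isCompact).image (by fun_prop)
  have hsub : Function.support Φ ⊆
      (fun q : ℝ × ℝ => (q.1, q.1 * q.2)) '' (tsupport χ ×ˢ tsupport ψ) := by
    intro p hp
    have h1 : χ p.1 ≠ 0 := left_ne_zero_of_mul hp
    have h2 : ψ (p.2 / p.1) ≠ 0 := right_ne_zero_of_mul hp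
    have h3 : p.1 ≠ 0 := fun h => h1 (hχz _ h.le)
    exact ⟨(p.1, p.2 / p.1), ⟨subset_tsupport _ h1, subset_tsupport _ h2⟩,
      Prod.ext rfl (mul_div_cancel₀ p.2 h3)⟩
  have hΦc : HasCompactSupport Φ := HasCompactSupport.of_support_subset_isCompact hK hsub
  have hΦs : tsupport Φ ⊆ Ioi (0 : ℝ) ×ˢ Ioi (0 : ℝ) := by
    refine (closure_minimal hsub hK.isClosed).trans ?_
    rintro _ ⟨q, ⟨h1, h2⟩, rfl⟩
    exact ⟨hχs h1, mem_Ioi.2 (mul_pos (mem_Ioi.1 (hχs h1)) (mem_Ioi.1 (hψs h2)))⟩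
  have hmeas : Measurable fun p : ℝ × ℝ => p.2 / p.1 := measurable_snd.div measurable_fst
  have hdint : ∀ w : ℝ × ℝ, Integrable fun p => fderiv ℝ Φ p w := fun w =>
    ((hΦd.continuous_fderiv (by simp)).clm_apply continuous_const).integrable_of_hasCompactSupport
      (hΦc.fderiv_apply ℝ w)
  have hint : Integrable fun p : ℝ × ℝ => u (p.2 / p.1) * fderiv ℝ Φ p (1, 0) +
      g (p.2 / p.1) * fderiv ℝ Φ p (0, 1) :=
    ((hdint _).bdd_mul (hu.comp hmeas).aestronglyMeasurable (.of_forall fun _ => hub _)).add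
      ((hdint _).bdd_mul (hg.comp hmeas).aestronglyMeasurable (.of_forall fun _ => hgb _))
  have hfd : ∀ t x : ℝ, fderiv ℝ Φ (t, x) (1, 0) =
        deriv χ t * ψ (x / t) - χ t / t * (x / t * deriv ψ (x / t)) ∧
      fderiv ℝ Φ (t, x) (0, 1) = χ t / t * deriv ψ (x / t) := by
    intro t x
    by_cases ht : t = 0
    · rw [(hΦ0 (t, x) ht).fderiv_eq]
      simp [ht, hχdz 0 le_rfl]
    · have hχ' : HasDerivAt χ (deriv χ t) t := (hχ.differentiable (by simp) t).hasDerivAt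
      have hψ' : HasDerivAt ψ (deriv ψ (x / t)) (x / t) :=
        (hψ.differentiable (by simp) _).hasDerivAt
      have hΦ' := (hΦd.differentiable (by simp) (t, x)).hasFDerivAt
      constructor
      · have hl : HasDerivAt (fun s : ℝ => (s, x)) (1, 0) t :=
          (hasDerivAt_id t).prodMk (hasDerivAt_const t x)
        have h1 : HasDerivAt (fun s : ℝ => Φ (s, x)) (fderiv ℝ Φ (t, x) (1, 0)) t :=
          HasFDerivAt.comp_hasDerivAt (f := fun s : ℝ => (s, x)) t hΦ' hl
        have h2 : HasDerivAt (fun s : ℝ => Φ (s, x)) _ t :=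
          hχ'.mul (hψ'.comp t ((hasDerivAt_const t x).div (hasDerivAt_id t) ht))
        rw [h1.unique h2]
        field_simp
        ring
      · have hl : HasDerivAt (fun y : ℝ => (t, y)) (0, 1) x :=
          (hasDerivAt_const x t).prodMk (hasDerivAt_id x)
        have h1 : HasDerivAt (fun y : ℝ => Φ (t, y)) (fderiv ℝ Φ (t, x) (0, 1)) x :=
          HasFDerivAt.comp_hasDerivAt (f := fun y : ℝ => (t, y)) x hΦ' hl
        have h2 : HasDerivAt (fun y : ℝ => Φ (t, y)) _ x :=
          (hψ'.comp x ((hasDerivAt_id x).div_const t)).const_mul (χ t)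
        rw [h1.unique h2]
        ring
  have hA : Integrable fun ξ => u ξ * ψ ξ :=
    (hψ.continuous.integrable_of_hasCompactSupport hψc).bdd_mul hu.aestronglyMeasurable
      (.of_forall hub)
  have hψ'c : Continuous (deriv ψ) := hψ.continuous_deriv (by simp)
  have hB : Integrable fun ξ => (g ξ - ξ * u ξ) * deriv ψ ξ := by
    have h1 : Integrable fun ξ => g ξ * deriv ψ ξ :=
      (hψ'c.integrable_of_hasCompactSupport hψc.deriv).bdd_mul hg.aestronglyMeasurable
        (.of_forall hgb)
    have h2 : Integrable fun ξ => u ξ * (ξ * deriv ψ ξ) :=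
      ((continuous_id.mul hψ'c).integrable_of_hasCompactSupport hψc.deriv.mul_left).bdd_mul
        hu.aestronglyMeasurable (.of_forall hub)
    refine (h1.sub h2).congr (.of_forall fun ξ => ?_)
    simp only [Pi.sub_apply]; ring
  have hinner : ∀ t : ℝ, ∫ x : ℝ, (u (x / t) * fderiv ℝ Φ (t, x) (1, 0) +
      g (x / t) * fderiv ℝ Φ (t, x) (0, 1)) =
      t * deriv χ t * (∫ ξ, u ξ * ψ ξ) + χ t * ∫ ξ, (g ξ - ξ * u ξ) * deriv ψ ξ := by
    intro t
    have e : ∀ x, u (x / t) * fderiv ℝ Φ (t, x) (1, 0) + g (x / t) * fderiv ℝ Φ (t, x) (0, 1) =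
        (fun ξ => deriv χ t * (u ξ * ψ ξ) + χ t / t * ((g ξ - ξ * u ξ) * deriv ψ ξ)) (x / t) := by
      intro x
      rw [(hfd t x).1, (hfd t x).2]; ring
    simp_rw [e]
    rw [Measure.integral_comp_div
        (fun ξ => deriv χ t * (u ξ * ψ ξ) + χ t / t * ((g ξ - ξ * u ξ) * deriv ψ ξ)) t,
      integral_add (hA.const_mul _) (hB.const_mul _), integral_const_mul, integral_const_mul]
    rcases le_or_gt t 0 with ht | ht
    · simp [hχz t ht, hχdz t ht]
    · rw [abs_of_pos ht, smul_eq_mul]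
      field_simp
  have h0 := hsol Φ hΦd hΦc hΦs
  rw [Measure.volume_eq_prod, integral_prod _ (by rwa [← Measure.volume_eq_prod])] at h0
  simp_rw [hinner] at h0
  have hχ'c : Continuous (deriv χ) := hχ.continuous_deriv (by simp)
  have hparts : ∫ t, t * deriv χ t = -1 := by
    have := integral_primitive_mul_deriv (locallyIntegrable_const (1 : ℝ)) hχ hχc hχs
    simpa [hχi] using this
  have i1 : Integrable fun t => t * deriv χ t :=
    (continuous_id.mul hχ'c).integrable_of_hasCompactSupport hχc.deriv.mul_left
  rw [integral_add (i1.mul_const _)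
    ((hχ.continuous.integrable_of_hasCompactSupport hχc).mul_const _), integral_mul_const,
    integral_mul_const, hparts, hχi] at h0
  linarith

/-- Being a self-similar solution only depends on the profile on `(0, ∞)`. -/
theorem IsSelfSimilarSolution.congr {n : ℕ} {F : (Fin n → ℝ) → (Fin n → ℝ)}
    {V W : ℝ → Fin n → ℝ} (h : IsSelfSimilarSolution n F V) (hVW : EqOn V W (Ioi 0)) :
    IsSelfSimilarSolution n F W := by
  intro φ hφ hc hs
  refine (integral_congr_ae (.of_forall fun p => ?_)).trans (h φ hφ hc hs)
  by_cases hp : p ∈ tsupport φ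
  · have : W (p.2 / p.1) = V (p.2 / p.1) := (hVW (mem_Ioi.2 (div_pos (hs hp).2 (hs hp).1))).symm
    simp only [this]
  · have : fderiv ℝ φ p = 0 :=
      image_eq_zero_of_notMem_tsupport fun h' => hp (tsupport_fderiv_subset ℝ h')
    simp [this]

/-- The profile of a self-similar solution satisfies the integrated form of
`(F(W) - ξ W)' + W = 0`. -/
theorem IsSelfSimilarSolution.exists_ae_eq_const {n : ℕ} {F : (Fin n → ℝ) → (Fin n → ℝ)}
    {W : ℝ → Fin n → ℝ} {M : ℝ} (hF : Continuous F) (hW : Measurable W)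
    (hM : ∀ ξ, ‖W ξ‖ ≤ M) (h : IsSelfSimilarSolution n F W) :
    ∃ c : Fin n → ℝ, ∀ᵐ ξ, ξ ∈ Ioi (0 : ℝ) →
      F (W ξ) - ξ • W ξ + ∫ s in (0 : ℝ)..ξ, W s = c := by
  obtain ⟨N, hN⟩ := (isCompact_closedBall (0 : Fin n → ℝ) M).exists_bound_of_continuousOn
    hF.continuousOn
  have hFb : ∀ ξ, ‖F (W ξ)‖ ≤ N := fun ξ => hN _ (by simpa using hM ξ)
  have hFW : Measurable fun ξ => F (W ξ) := hF.measurable.comp hW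
  have hloc : ∀ {w : ℝ → ℝ} {R : ℝ}, Measurable w → (∀ ξ, ‖w ξ‖ ≤ R) → LocallyIntegrable w :=
    fun {_ R} hw hR => (locallyIntegrable_const R).mono hw.aestronglyMeasurable
      (.of_forall fun ξ => (hR ξ).trans (le_abs_self _))
  have hWloc : ∀ i, LocallyIntegrable fun ξ => W ξ i := fun i =>
    hloc (measurable_pi_iff.1 hW i) fun ξ => (norm_le_pi_norm _ i).trans (hM ξ)
  have hFloc : ∀ i, LocallyIntegrable fun ξ => F (W ξ) i := fun i =>
    hloc (measurable_pi_iff.1 hFW i) fun ξ => (norm_le_pi_norm _ i).trans (hFb ξ)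
  have hcoord : ∀ i, ∃ c : ℝ, ∀ᵐ ξ, ξ ∈ Ioi (0 : ℝ) →
      F (W ξ) i - ξ * W ξ i + ∫ s in (0 : ℝ)..ξ, W s i = c := by
    intro i
    have hPc : Continuous fun ξ => ∫ s in (0 : ℝ)..ξ, W s i :=
      intervalIntegral.continuous_primitive (fun a b =>
        ((hWloc i).integrableOn_isCompact isCompact_uIcc).intervalIntegrable) 0
    have hgloc : LocallyIntegrable fun ξ => F (W ξ) i - ξ * W ξ i :=
      (hFloc i).sub ((hWloc i).continuous_mul continuous_id)
    refine ae_eq_const_of_integral_mul_deriv_eq_zero (hgloc.add hPc.locallyIntegrable) ?_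
    intro ψ hψ hψc hψs
    have hψ'c : Continuous (deriv ψ) := hψ.continuous_deriv (by simp)
    have hprof := integral_profile_mul_deriv (u := fun ξ => W ξ i) (g := fun ξ => F (W ξ) i)
      (M := max M N) (measurable_pi_iff.1 hW i) (measurable_pi_iff.1 hFW i)
      (fun ξ => ((norm_le_pi_norm _ i).trans (hM ξ)).trans (le_max_left _ _))
      (fun ξ => ((norm_le_pi_norm _ i).trans (hFb ξ)).trans (le_max_right _ _)) ?_ hψ hψc hψs
    · have hparts := integral_primitive_mul_deriv (hWloc i) hψ hψc hψs
      simp only [add_mul]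
      rw [integral_add, hprof, hparts, add_neg_cancel]
      · simpa [mul_comm] using hgloc.integrable_smul_left_of_hasCompactSupport hψ'c hψc.deriv
      · exact (hPc.mul hψ'c).integrable_of_hasCompactSupport hψc.deriv.mul_left
    · intro Φ hΦ hΦc hΦs
      have hfd : ∀ p w, fderiv ℝ (fun q => Φ q • (Pi.single i 1 : Fin n → ℝ)) p w =
          Pi.single i (fderiv ℝ Φ p w) := by
        intro p w
        rw [fderiv_smul_const (hΦ.differentiable (by simp) p)]
        ext j
        by_cases hj : j = i
        · subst hj; simp
        · simp [hj]
      have := h (fun p => Φ p • Pi.single i 1) (hΦ.smul contDiff_const) hΦc.smul_right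
        ((closure_mono (Function.support_smul_subset_left _ _)).trans hΦs)
      simpa only [hfd, dotProduct_single] using this
  choose c hc using hcoord
  refine ⟨c, ?_⟩
  filter_upwards [ae_all_iff.2 hc] with ξ hξ hpos
  ext i
  have hint : (∫ s in (0 : ℝ)..ξ, W s) i = ∫ s in (0 : ℝ)..ξ, W s i := by
    simp only [intervalIntegral.integral_of_le (mem_Ioi.1 hpos).le]
    exact eval_integral (fun j => (((hWloc j).integrableOn_isCompact isCompact_Icc).mono_set
      Ioc_subset_Icc_self)) i
  simpa [hint] using hξ i hpos

/-- If `DF(W(ξ₀)) - ξ₀` is bounded below, then near the continuity point `ξ₀` a profile satisfying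
the integrated equation `F(W) - ξ W + ∫ W = c` is almost everywhere constant. -/
theorem exists_ae_eq_const_of_antilipschitz {E : Type*} [NormedAddCommGroup E] [NormedSpace ℝ E]
    [CompleteSpace E] {F : E → E} {L : E →L[ℝ] E} {W : ℝ → E} {M ξ₀ : ℝ} {c : E} {K : NNReal}
    (hWi : LocallyIntegrable W) (hM : ∀ ξ, ‖W ξ‖ ≤ M) (hξ₀ : 0 < ξ₀)
    (hcont : ContinuousAt W ξ₀) (hF : HasStrictFDerivAt F L (W ξ₀)) (hK : 0 < K)
    (hL : AntilipschitzWith K (L - ξ₀ • ContinuousLinearMap.id ℝ E))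
    (heq : ∀ᵐ ξ, ξ ∈ Ioi (0 : ℝ) → F (W ξ) - ξ • W ξ + ∫ s in (0 : ℝ)..ξ, W s = c) :
    ∃ ε > (0 : ℝ), ∃ w : E, ∀ᵐ ξ, ξ ∈ Ioo (ξ₀ - ε) (ξ₀ + ε) → W ξ = w := by
  have hK' : (0 : ℝ) < K := hK
  obtain ⟨s, hs, hsF⟩ := hF.approximates_deriv_on_nhds (c := (4 * K)⁻¹) (.inr (by positivity))
  obtain ⟨δ, hδ, hδs⟩ := Metric.mem_nhds_iff.1 (hcont.preimage_mem_nhds hs)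
  obtain ⟨ε, hε, hεδ, hεξ, hεK⟩ : ∃ ε > (0 : ℝ), ε ≤ δ ∧ ε ≤ ξ₀ ∧ ε * (8 * K) ≤ 1 := by
    refine ⟨min (min δ ξ₀) (1 / (8 * K)), by positivity, ?_, ?_, ?_⟩
    · exact (min_le_left _ _).trans (min_le_left _ _)
    · exact (min_le_left _ _).trans (min_le_right _ _)
    · exact (le_div_iff₀ (by positivity)).1 (min_le_right _ _)
  refine ⟨ε, hε, ?_⟩
  set S : Set ℝ := {ξ | ξ ∈ Ioo (ξ₀ - ε) (ξ₀ + ε) ∧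
    F (W ξ) - ξ • W ξ + ∫ s in (0 : ℝ)..ξ, W s = c} with hS
  have hSae : ∀ᵐ ξ, ξ ∈ Ioo (ξ₀ - ε) (ξ₀ + ε) → ξ ∈ S := by
    filter_upwards [heq] with ξ hξ hI
    exact ⟨hI, hξ (mem_Ioi.2 (by linarith [hI.1]))⟩
  rcases S.eq_empty_or_nonempty with hSe | ⟨η, hη⟩
  · refine ⟨0, ?_⟩
    filter_upwards [hSae] with ξ hξ hI
    exact absurd (hξ hI) (by simp [hSe])
  have hWs : ∀ ξ ∈ Ioo (ξ₀ - ε) (ξ₀ + ε), W ξ ∈ s := fun ξ hξ =>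
    hδs (by rw [Real.ball_eq_Ioo]; exact ⟨by linarith [hξ.1], by linarith [hξ.2]⟩)
  have hhalf : ∀ m : ℝ, (∀ ξ ∈ S, ‖W ξ - W η‖ ≤ m) → ∀ ξ ∈ S, ‖W ξ - W η‖ ≤ m / 2 := by
    intro m hm ξ hξ
    have hm0 : 0 ≤ m := (norm_nonneg _).trans (hm ξ hξ)
    have hint : ∀ a b, IntervalIntegrable W volume a b := fun a b =>
      (hWi.integrableOn_isCompact isCompact_uIcc).intervalIntegrable
    have hR : ‖∫ s in η..ξ, (W s - W η)‖ ≤ m * (2 * ε) := by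
      refine (intervalIntegral.norm_integral_le_of_norm_le_const_ae (C := m) ?_).trans ?_
      · filter_upwards [hSae] with x hx hxI
        exact hm x (hx ((ordConnected_Ioo.uIcc_subset hη.1 hξ.1) (uIoc_subset_uIcc hxI)))
      · refine mul_le_mul_of_nonneg_left (abs_le.2 ⟨?_, ?_⟩) hm0 <;>
          linarith [hη.1.1, hη.1.2, hξ.1.1, hξ.1.2]
    have hdiff : F (W ξ) - F (W η) - ξ • (W ξ - W η) = -∫ s in η..ξ, (W s - W η) := by
      have h1 : ∫ s in η..ξ, (W s - W η) =
          (∫ s in (0 : ℝ)..ξ, W s) - (∫ s in (0 : ℝ)..η, W s) - (ξ - η) • W η := by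
        rw [intervalIntegral.integral_sub (hint _ _) intervalIntegrable_const,
          intervalIntegral.integral_const,
          intervalIntegral.integral_interval_sub_left (hint _ _) (hint _ _)]
      have h2 := hξ.2.trans hη.2.symm
      rw [h1]
      linear_combination (norm := module) h2
    have hlow := hL.le_mul_dist (W ξ) (W η)
    rw [dist_eq_norm, dist_eq_norm, ← map_sub] at hlow
    have hsplit : (L - ξ₀ • ContinuousLinearMap.id ℝ E) (W ξ - W η) =
        -(F (W ξ) - F (W η) - L (W ξ - W η)) + (ξ - ξ₀) • (W ξ - W η) -
          ∫ s in η..ξ, (W s - W η) := by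
      simp only [_root_.sub_apply, _root_.smul_apply, ContinuousLinearMap.id_apply]
      linear_combination (norm := module) hdiff
    have herr : ‖F (W ξ) - F (W η) - L (W ξ - W η)‖ ≤ (4 * K : ℝ)⁻¹ * ‖W ξ - W η‖ := by
      simpa using hsF (W ξ) (hWs ξ hξ.1) (W η) (hWs η hη.1)
    have hlin : ‖(ξ - ξ₀) • (W ξ - W η)‖ ≤ ε * ‖W ξ - W η‖ := by
      rw [norm_smul]
      refine mul_le_mul_of_nonneg_right (abs_le.2 ⟨?_, ?_⟩) (norm_nonneg _) <;>
        linarith [hξ.1.1, hξ.1.2]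
    have hup : ‖(L - ξ₀ • ContinuousLinearMap.id ℝ E) (W ξ - W η)‖ ≤
        (4 * K : ℝ)⁻¹ * ‖W ξ - W η‖ + ε * ‖W ξ - W η‖ + m * (2 * ε) := by
      rw [hsplit]
      refine (norm_sub_le _ _).trans (add_le_add ((norm_add_le _ _).trans (add_le_add ?_ hlin)) hR)
      rwa [norm_neg]
    have hfin := hlow.trans (mul_le_mul_of_nonneg_left hup hK'.le)
    have hKK : (K : ℝ) * (4 * K : ℝ)⁻¹ = 1 / 4 := by field_simp
    have hn := norm_nonneg (W ξ - W η)
    nlinarith [mul_le_mul_of_nonneg_right hεK hn, mul_le_mul_of_nonneg_right hεK hm0]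
  have hbdd : BddAbove ((fun ξ => ‖W ξ - W η‖) '' S) := by
    refine ⟨M + M, ?_⟩
    rintro _ ⟨ξ, -, rfl⟩
    exact (norm_sub_le _ _).trans (add_le_add (hM _) (hM _))
  set m := sSup ((fun ξ => ‖W ξ - W η‖) '' S) with hm
  have hle : ∀ ξ ∈ S, ‖W ξ - W η‖ ≤ m := fun ξ hξ => le_csSup hbdd (mem_image_of_mem _ hξ)
  have hm2 : m ≤ m / 2 := csSup_le ⟨_, mem_image_of_mem _ hη⟩ (by
    rintro _ ⟨ξ, hξ, rfl⟩
    exact hhalf m hle ξ hξ)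
  refine ⟨W η, ?_⟩
  filter_upwards [hSae] with ξ hξ hI
  exact sub_eq_zero.1 (norm_le_zero_iff.1 ((hle ξ (hξ hI)).trans (by linarith)))

/-- If `μ` is not an eigenvalue of the Jacobian matrix, then `DF(U) - μ` is bounded below. -/
theorem exists_antilipschitzWith_of_det_jacobianMatrix_ne_zero {n : ℕ}
    {F : (Fin n → ℝ) → (Fin n → ℝ)} {U : Fin n → ℝ} {μ : ℝ}
    (h : (jacobianMatrix F U - μ • (1 : Matrix (Fin n) (Fin n) ℝ)).det ≠ 0) :
    ∃ K : NNReal, 0 < K ∧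
      AntilipschitzWith K (fderiv ℝ F U - μ • ContinuousLinearMap.id ℝ (Fin n → ℝ)) := by
  set A := fderiv ℝ F U - μ • ContinuousLinearMap.id ℝ (Fin n → ℝ) with hA
  have hmat : LinearMap.toMatrix' (A : (Fin n → ℝ) →ₗ[ℝ] (Fin n → ℝ)) =
      jacobianMatrix F U - μ • (1 : Matrix (Fin n) (Fin n) ℝ) := by
    ext i j
    simp [LinearMap.toMatrix'_apply, hA, jacobianMatrix, Matrix.one_apply, Pi.single_apply]
  rw [← hmat, LinearMap.det_toMatrix'] at h
  exact LinearMap.exists_antilipschitzWith (A : (Fin n → ℝ) →ₗ[ℝ] (Fin n → ℝ))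
    ((LinearMap.isUnit_iff_ker_eq_bot _).1 ((LinearMap.isUnit_iff_isUnit_det _).2 h.isUnit))

/-- first half of part (3) of Lemma 2.1. If `ξ₀ > 0` is a continuity
point of `V` belonging to the support of the distributional derivative of `V` (i.e. `V` is
not a.e. constant on any open neighborhood of `ξ₀`), then `ξ₀` is an eigenvalue of the
Jacobian matrix `DF(V(ξ₀))`. -/
theorem continuity_point_is_eigenvalue (n : ℕ) (hn : 1 ≤ n)
    (F : (Fin n → ℝ) → (Fin n → ℝ)) (hF : ContDiff ℝ 1 F)
    (V : ℝ → Fin n → ℝ)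
    (hbd : ∃ M : ℝ, ∀ ξ, 0 < ξ → ‖V ξ‖ ≤ M)
    (hBV : BoundedVariationOn V (Set.Ioi 0))
    (hsol : IsSelfSimilarSolution n F V)
    (ξ₀ : ℝ) (hξ₀ : 0 < ξ₀)
    (hcont : ContinuousAt V ξ₀)
    (hnc : ∀ ε > (0 : ℝ), ¬ ∃ c : Fin n → ℝ,
      ∀ᵐ ξ ∂(volume : Measure ℝ), ξ ∈ Set.Ioo (ξ₀ - ε) (ξ₀ + ε) → V ξ = c) :
    (jacobianMatrix F (V ξ₀) - ξ₀ • (1 : Matrix (Fin n) (Fin n) ℝ)).det = 0 := by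
  by_contra hdet
  obtain ⟨K, hK, hL⟩ := exists_antilipschitzWith_of_det_jacobianMatrix_ne_zero hdet
  obtain ⟨M, hM⟩ := hbd
  set W := (Ioi (0 : ℝ)).indicator V with hW
  have hVW : EqOn V W (Ioi 0) := fun ξ hξ => (indicator_of_mem hξ V).symm
  have hWm : Measurable W := measurable_indicator_of_boundedVariationOn_Ioi hBV
  have hWM : ∀ ξ, ‖W ξ‖ ≤ M := fun ξ => by
    by_cases hξ : ξ ∈ Ioi (0 : ℝ)
    · exact hVW hξ ▸ hM ξ hξ
    · rw [hW, indicator_of_notMem hξ, norm_zero]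
      exact (norm_nonneg _).trans (hM ξ₀ hξ₀)
  have hWi : LocallyIntegrable W := (locallyIntegrable_const M).mono hWm.aestronglyMeasurable
    (.of_forall fun ξ => (hWM ξ).trans (le_abs_self _))
  obtain ⟨c, hc⟩ := (hsol.congr hVW).exists_ae_eq_const hF.continuous hWm hWM
  have hWc : ContinuousAt W ξ₀ :=
    hcont.congr (Filter.eventuallyEq_of_mem (Ioi_mem_nhds hξ₀) hVW)
  have hFs : HasStrictFDerivAt F (fderiv ℝ F (V ξ₀)) (W ξ₀) :=
    hVW hξ₀ ▸ hF.contDiffAt.hasStrictFDerivAt one_ne_zero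
  obtain ⟨ε, hε, w, hw⟩ :=
    exists_ae_eq_const_of_antilipschitz hWi hWM hξ₀ hWc hFs hK hL hc
  refine hnc (min ε ξ₀) (lt_min hε hξ₀) ⟨w, ?_⟩
  filter_upwards [hw] with ξ hξ hI
  have h1 := min_le_left ε ξ₀
  have h2 := min_le_right ε ξ₀
  rw [hVW (mem_Ioi.2 (by linarith [hI.1])), hξ ⟨by linarith [hI.1], by linarith [hI.2]⟩]
end

section
/- Let n ≥ 1, let F : ℝⁿ → ℝⁿ be smooth, and let V : (0,∞) → ℝⁿ be a bounded function of bounded total variation such that U(t,x) := V(x/t) is a distributional solution of ∂ₜU + ∂ₓF(U) = 0 on (0,∞) × (0,∞). Let I ⊆ (0,∞) be an open interval such that V is continuous on I and V is not almost everywhere constant on any open subinterval of I. Suppose there exist a continuously differentiable function λ : ℝⁿ → ℝ and a continuously differentiable vector field r : ℝⁿ → ℝⁿ, defined on an open neighborhood of the closure of V(I), such that for every W in this neighborhood: ‖r(W)‖ = 1, DF(W) r(W) = λ(W) r(W), and λ(W) is a simple eigenvalue of DF(W); and suppose λ(V(ξ)) = ξ and ∇λ(V(ξ)) · r(V(ξ))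 ≠ 0 for every ξ ∈ I. Then V is differentiable at every point of I. -/
open Matrix MeasureTheory

open Set Filter Topology Asymptotics

/-- If `G ∘ V` is differentiable at `x`, `G` has injective derivative at `V x` and `V` is continuous
at `x`, then `V` is differentiable at `x`. -/
theorem DifferentiableAt.of_comp_injective_fderiv {E E' : Type*}
    [NormedAddCommGroup E] [NormedSpace ℝ E] [FiniteDimensional ℝ E]
    [NormedAddCommGroup E'] [NormedSpace ℝ E'] [FiniteDimensional ℝ E']
    {V : ℝ → E} {G : E → E'} {L : E →L[ℝ] E'} {x : ℝ}
    (hV : ContinuousAt V x) (hG : HasFDerivAt G L (V x)) (hL : Function.Injective L)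
    (hGV : DifferentiableAt ℝ (fun y => G (V y)) x) : DifferentiableAt ℝ V x := by
  obtain ⟨M, hM⟩ := L.toLinearMap.exists_leftInverse_of_injective (LinearMap.ker_eq_bot.2 hL)
  have hML : ∀ w, M (L w) = w := fun w => LinearMap.congr_fun hM w
  let M' : E' →L[ℝ] E := LinearMap.toContinuousLinearMap M
  have hMG : HasFDerivAt (fun w => M' (G w)) (ContinuousLinearMap.id ℝ E) (V x) := by
    have h := M'.hasFDerivAt.comp (V x) hG
    have hid : M'.comp L = ContinuousLinearMap.id ℝ E := by
      ext w
      exact hML w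
    rwa [hid] at h
  have hd : HasDerivAt (fun y => M' (G (V y))) (deriv (fun y => M' (G (V y))) x) x :=
    (M'.differentiableAt.comp x hGV).hasDerivAt
  have h₁ : (fun y => M' (G (V y)) - M' (G (V x)) - (V y - V x)) =o[𝓝 x] fun y => V y - V x :=
    hMG.isLittleO.comp_tendsto hV
  have h₂ : (fun y => V y - V x) =O[𝓝 x] fun y => y - x := by
    refine h₁.right_isBigO_add.trans ?_
    simpa using hd.isBigO_sub
  refine HasDerivAt.differentiableAt (f' := deriv (fun y => M' (G (V y))) x) ?_
  rw [hasDerivAt_iff_isLittleO]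
  refine ((hasDerivAt_iff_isLittleO.1 hd).sub (h₁.trans_isBigO h₂)).congr_left fun y => ?_
  abel

/-- The eigenspace of a simple root of the characteristic polynomial is a line. -/
theorem Matrix.exists_smul_eq_of_rootMultiplicity_charpoly_eq_one {n : ℕ}
    {A : Matrix (Fin n) (Fin n) ℝ} {μ : ℝ} (h : A.charpoly.rootMultiplicity μ = 1)
    {v w : Fin n → ℝ} (hv : v ≠ 0) (hAv : A *ᵥ v = μ • v) (hAw : A *ᵥ w = μ • w) :
    ∃ c : ℝ, w = c • v := by
  have hle : Module.finrank ℝ (Module.End.eigenspace (Matrix.toLin' A) μ) ≤ 1 := by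
    rw [← h, ← Matrix.charpoly_toLin']
    exact LinearMap.finrank_eigenspace_le _ _
  have hmem : ∀ u, A *ᵥ u = μ • u → u ∈ Module.End.eigenspace (Matrix.toLin' A) μ := fun u hu => by
    rwa [Module.End.mem_eigenspace_iff, Matrix.toLin'_apply]
  obtain ⟨u, hu⟩ := finrank_le_one_iff.1 hle
  obtain ⟨c, hc⟩ := hu ⟨v, hmem v hAv⟩
  obtain ⟨d, hd⟩ := hu ⟨w, hmem w hAw⟩
  have hc' : c • (u : Fin n → ℝ) = v := congrArg Subtype.val hc
  have hd' : d • (u : Fin n → ℝ) = w := congrArg Subtype.val hd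
  have hc0 : c ≠ 0 := by
    rintro rfl
    exact hv (by rw [← hc', zero_smul])
  refine ⟨d / c, ?_⟩
  rw [← hc', ← hd', smul_smul, div_mul_cancel₀ _ hc0]

/-- The primitive of a smooth function supported in `(a, b)` with vanishing integral is again
smooth with compact support in `(a, b)`. -/
theorem exists_contDiff_deriv_eq_of_integral_eq_zero {a b : ℝ} {g : ℝ → ℝ}
    (hg : ContDiff ℝ (⊤ : ℕ∞) g) (hc : HasCompactSupport g) (hs : tsupport g ⊆ Ioo a b)
    (h0 : ∫ x, g x = 0) :
    ∃ ψ : ℝ → ℝ, ContDiff ℝ (⊤ : ℕ∞) ψ ∧ HasCompactSupport ψ ∧ tsupport ψ ⊆ Ioo a b ∧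
      deriv ψ = g := by
  rcases (tsupport g).eq_empty_or_nonempty with he | hne
  · rw [tsupport_eq_empty_iff] at he
    subst he
    refine ⟨0, contDiff_const, HasCompactSupport.zero, by simp, ?_⟩
    ext x
    simp
  have hK : IsCompact (tsupport g) := hc
  obtain ⟨c, hcK, hcmin⟩ := hK.exists_isLeast hne
  obtain ⟨d, hdK, hdmax⟩ := hK.exists_isGreatest hne
  have hIcc : Icc c d ⊆ Ioo a b := fun x hx => ⟨(hs hcK).1.trans_le hx.1, hx.2.trans_lt (hs hdK).2⟩
  have hzero : ∀ x, x ∉ Icc c d → g x = 0 := fun x hx => by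
    by_contra hgx
    exact hx ⟨hcmin (subset_tsupport _ hgx), hdmax (subset_tsupport _ hgx)⟩
  have hcd : c ≤ d := hcmin hdK
  have hder : ∀ x, HasDerivAt (fun x => ∫ t in c..x, g t) (g x) x := fun x =>
    (hg.continuous.integral_hasStrictDerivAt c x).hasDerivAt
  have hderiv : deriv (fun x => ∫ t in c..x, g t) = g := funext fun x => (hder x).deriv
  have hout : ∀ x, x ∉ Icc c d → ∫ t in c..x, g t = 0 := by
    intro x hx
    rcases lt_or_ge x c with hxc | hxc
    · rw [intervalIntegral.integral_symm, intervalIntegral.integral_of_le hxc.le,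
        integral_Ioc_eq_integral_Ioo, setIntegral_eq_zero_of_forall_eq_zero, neg_zero]
      exact fun t ht => hzero t fun h => ht.2.not_ge h.1
    · have hdx : d < x := not_le.1 fun h => hx ⟨hxc, h⟩
      rw [intervalIntegral.integral_of_le hxc, ← integral_Icc_eq_integral_Ioc,
        setIntegral_eq_integral_of_forall_compl_eq_zero, h0]
      exact fun t ht => hzero t fun h => ht ⟨h.1, h.2.trans hdx.le⟩
  refine ⟨fun x => ∫ t in c..x, g t, ?_, HasCompactSupport.intro isCompact_Icc hout, ?_, hderiv⟩
  · rw [contDiff_infty_iff_deriv, hderiv]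
    exact ⟨fun x => (hder x).differentiableAt, hg⟩
  · refine (closure_minimal ?_ isClosed_Icc).trans hIcc
    exact fun x hx => by_contra fun h => hx (hout x h)

/-- The lemma of du Bois-Reymond for continuous functions. -/
theorem Continuous.exists_eqOn_const_of_integral_mul_deriv_eq_zero {a b : ℝ} (hab : a < b)
    {H : ℝ → ℝ} (hH : Continuous H)
    (h : ∀ ψ : ℝ → ℝ, ContDiff ℝ (⊤ : ℕ∞) ψ → HasCompactSupport ψ → tsupport ψ ⊆ Ioo a b →
      ∫ x, H x * deriv ψ x = 0) :
    ∃ c : ℝ, EqOn H (fun _ => c) (Ioo a b) := by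
  let ρ₀ : ContDiffBump ((a + b) / 2) := ⟨(b - a) / 8, (b - a) / 4, by linarith, by linarith⟩
  let ρ : ℝ → ℝ := ρ₀.normed volume
  have hρd : ContDiff ℝ (⊤ : ℕ∞) ρ := ρ₀.contDiff_normed
  have hρc : HasCompactSupport ρ := ρ₀.hasCompactSupport_normed
  have hρs : tsupport ρ ⊆ Ioo a b := by
    rw [ρ₀.tsupport_normed_eq, Real.closedBall_eq_Icc]
    refine Icc_subset_Ioo ?_ ?_ <;> simp only [ρ₀] <;> linarith
  have hρi : ∫ x, ρ x = 1 := ρ₀.integral_normed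
  have hint : ∀ {k l : ℝ → ℝ}, Continuous k → Continuous l → HasCompactSupport l →
      Integrable (fun x => k x * l x) := fun hk hl hlc =>
    (hk.mul hl).integrable_of_hasCompactSupport hlc.mul_left
  refine ⟨∫ x, H x * ρ x, ?_⟩
  have hae : ∀ᵐ x, x ∈ Ioo a b → H x - ∫ x, H x * ρ x = 0 := by
    refine isOpen_Ioo.ae_eq_zero_of_integral_contDiff_smul_eq_zero
      ((hH.sub continuous_const).locallyIntegrable.locallyIntegrableOn _) fun g hg hgc hgs => ?_
    have hgi : Integrable g := hg.continuous.integrable_of_hasCompactSupport hgc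
    have hρint : Integrable ρ := hρd.continuous.integrable_of_hasCompactSupport hρc
    obtain ⟨ψ, hψ, hψc, hψs, hψ'⟩ := exists_contDiff_deriv_eq_of_integral_eq_zero (a := a) (b := b)
      (g := fun x => g x - (∫ x, g x) * ρ x) (hg.sub (contDiff_const.mul hρd))
      (hgc.sub hρc.mul_left)
      ((tsupport_sub _ _).trans (union_subset hgs ((tsupport_mul_subset_right).trans hρs)))
      (by rw [integral_sub hgi (hρint.const_mul _), integral_const_mul, hρi, mul_one, sub_self])
    have := h ψ hψ hψc hψs
    rw [hψ'] at this
    have e₁ : ∀ x, H x * (g x - (∫ x, g x) * ρ x) = H x * g x - (∫ x, g x) * (H x * ρ x) :=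
      fun x => by ring
    have e₂ : ∀ x, g x • (H x - ∫ x, H x * ρ x) = H x * g x - (∫ x, H x * ρ x) * g x :=
      fun x => by rw [smul_eq_mul]; ring
    simp_rw [e₁] at this
    rw [integral_sub (hint hH hg.continuous hgc) ((hint hH hρd.continuous hρc).const_mul _),
      integral_const_mul] at this
    simp_rw [e₂]
    rw [integral_sub (hint hH hg.continuous hgc) (hgi.const_mul _), integral_const_mul]
    linarith
  refine Measure.eqOn_open_of_ae_eq (μ := volume) ?_ isOpen_Ioo hH.continuousOn continuousOn_const
  rw [EventuallyEq, ae_restrict_iff' measurableSet_Ioo]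
  filter_upwards [hae] with x hx hxI using sub_eq_zero.1 (hx hxI)

section SelfSimilarTestFunction

variable {χ ψ : ℝ → ℝ}

theorem tsupport_mul_comp_div_subset (hχc : HasCompactSupport χ) (hχs : tsupport χ ⊆ Ioi 0)
    (hψc : HasCompactSupport ψ) :
    tsupport (fun p : ℝ × ℝ => χ p.1 * ψ (p.2 / p.1)) ⊆
      (fun q : ℝ × ℝ => (q.1, q.1 * q.2)) '' (tsupport χ ×ˢ tsupport ψ) := by
  have hK : IsCompact ((fun q : ℝ × ℝ => (q.1, q.1 * q.2)) '' (tsupport χ ×ˢ tsupport ψ)) :=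
    (hχc.isCompact.prod hψc.isCompact).image (by fun_prop)
  refine closure_minimal (fun p hp => ?_) hK.isClosed
  have h₁ : p.1 ∈ tsupport χ := subset_tsupport _ (left_ne_zero_of_mul hp)
  have h₂ : p.2 / p.1 ∈ tsupport ψ := subset_tsupport _ (right_ne_zero_of_mul hp)
  have h₀ : p.1 ≠ 0 := (mem_Ioi.1 (hχs h₁)).ne'
  exact ⟨(p.1, p.2 / p.1), ⟨h₁, h₂⟩, Prod.ext rfl (mul_div_cancel₀ _ h₀)⟩

theorem hasCompactSupport_mul_comp_div (hχc : HasCompactSupport χ) (hχs : tsupport χ ⊆ Ioi 0)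
    (hψc : HasCompactSupport ψ) :
    HasCompactSupport (fun p : ℝ × ℝ => χ p.1 * ψ (p.2 / p.1)) :=
  ((hχc.isCompact.prod hψc.isCompact).image (by fun_prop)).of_isClosed_subset
    (isClosed_tsupport _) (tsupport_mul_comp_div_subset hχc hχs hψc)

theorem fst_pos_of_mem_tsupport (hχc : HasCompactSupport χ) (hχs : tsupport χ ⊆ Ioi 0)
    (hψc : HasCompactSupport ψ) {p : ℝ × ℝ}
    (hp : p ∈ tsupport (fun p : ℝ × ℝ => χ p.1 * ψ (p.2 / p.1))) : 0 < p.1 := by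
  obtain ⟨q, hq, rfl⟩ := tsupport_mul_comp_div_subset hχc hχs hψc hp
  exact hχs hq.1

theorem contDiff_mul_comp_div (hχ : ContDiff ℝ (⊤ : ℕ∞) χ) (hχc : HasCompactSupport χ)
    (hχs : tsupport χ ⊆ Ioi 0) (hψ : ContDiff ℝ (⊤ : ℕ∞) ψ) (hψc : HasCompactSupport ψ) :
    ContDiff ℝ (⊤ : ℕ∞) (fun p : ℝ × ℝ => χ p.1 * ψ (p.2 / p.1)) := by
  refine contDiff_iff_contDiffAt.2 fun p => ?_
  by_cases hp : p ∈ tsupport (fun p : ℝ × ℝ => χ p.1 * ψ (p.2 / p.1))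
  swap
  · exact contDiffAt_const.congr_of_eventuallyEq (notMem_tsupport_iff_eventuallyEq.1 hp)
  have h₀ : p.1 ≠ 0 := (fst_pos_of_mem_tsupport hχc hχs hψc hp).ne'
  exact (hχ.contDiffAt.comp p contDiffAt_fst).mul
    (hψ.contDiffAt.comp p (contDiffAt_snd.div contDiffAt_fst h₀))

theorem fderiv_mul_comp_div_apply (hχ : ContDiff ℝ (⊤ : ℕ∞) χ) (hψ : ContDiff ℝ (⊤ : ℕ∞) ψ)
    {t : ℝ} (ht : t ≠ 0) (ξ : ℝ) (v : ℝ × ℝ) :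
    fderiv ℝ (fun p : ℝ × ℝ => χ p.1 * ψ (p.2 / p.1)) (t, t * ξ) v =
      deriv χ t * v.1 * ψ ξ + χ t * (deriv ψ ξ * ((v.2 - ξ * v.1) / t)) := by
  have hξ : t * ξ / t = ξ := mul_div_cancel_left₀ _ ht
  have hd : HasFDerivAt (fun p : ℝ × ℝ => p.2 / p.1)
      (t⁻¹ • (ContinuousLinearMap.snd ℝ ℝ ℝ) - (ξ / t) • ContinuousLinearMap.fst ℝ ℝ ℝ)
      (t, t * ξ) := by
    have hinv : HasFDerivAt (fun p : ℝ × ℝ => p.1⁻¹)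
        (-(t ^ 2)⁻¹ • ContinuousLinearMap.fst ℝ ℝ ℝ) (t, t * ξ) :=
      HasDerivAt.comp_hasFDerivAt (x := ((t, t * ξ) : ℝ × ℝ)) (hasDerivAt_inv ht) hasFDerivAt_fst
    have hsnd : HasFDerivAt (fun p : ℝ × ℝ => p.2) (ContinuousLinearMap.snd ℝ ℝ ℝ) (t, t * ξ) :=
      hasFDerivAt_snd
    have h : HasFDerivAt (fun p : ℝ × ℝ => p.2 / p.1) _ (t, t * ξ) := hsnd.mul hinv
    refine h.congr_fderiv ?_
    ext <;> simp
    field_simp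
  have h₁ : HasFDerivAt (fun p : ℝ × ℝ => χ p.1) (deriv χ t • ContinuousLinearMap.fst ℝ ℝ ℝ)
      (t, t * ξ) :=
    HasDerivAt.comp_hasFDerivAt (x := ((t, t * ξ) : ℝ × ℝ))
      ((hχ.differentiable (by simp)) t).hasDerivAt hasFDerivAt_fst
  have h₂ : HasFDerivAt (fun p : ℝ × ℝ => ψ (p.2 / p.1)) (deriv ψ ξ •
      (t⁻¹ • (ContinuousLinearMap.snd ℝ ℝ ℝ) - (ξ / t) • ContinuousLinearMap.fst ℝ ℝ ℝ))
      (t, t * ξ) := by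
    refine HasDerivAt.comp_hasFDerivAt (x := ((t, t * ξ) : ℝ × ℝ)) ?_ hd
    simp only [hξ]
    exact ((hψ.differentiable (by simp)) ξ).hasDerivAt
  have h : HasFDerivAt (fun p : ℝ × ℝ => χ p.1 * ψ (p.2 / p.1)) _ (t, t * ξ) := h₁.mul h₂
  rw [h.fderiv]
  simp [hξ]
  field_simp
  ring

/-- Testing against `χ t * ψ (x / t)` factors through the self-similar variable `ξ = x / t`. -/
theorem integral_selfSimilar_mul_fderiv {f g : ℝ → ℝ} (hf : Continuous f) (hg : Continuous g)
    (hχ : ContDiff ℝ (⊤ : ℕ∞) χ) (hχc : HasCompactSupport χ)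
    (hχs : tsupport χ ⊆ Ioi 0) (hψ : ContDiff ℝ (⊤ : ℕ∞) ψ) (hψc : HasCompactSupport ψ) :
    ∫ p : ℝ × ℝ,
      (f (p.2 / p.1) * fderiv ℝ (fun p : ℝ × ℝ => χ p.1 * ψ (p.2 / p.1)) p (1, 0) +
        g (p.2 / p.1) * fderiv ℝ (fun p : ℝ × ℝ => χ p.1 * ψ (p.2 / p.1)) p (0, 1)) =
      (∫ t, χ t) * ((∫ ξ, (g ξ - ξ * f ξ) * deriv ψ ξ) - ∫ ξ, f ξ * ψ ξ) := by
  set θ : ℝ × ℝ → ℝ := fun p => χ p.1 * ψ (p.2 / p.1) with hθ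
  have hθd : ContDiff ℝ (⊤ : ℕ∞) θ := contDiff_mul_comp_div hχ hχc hχs hψ hψc
  have hθc : HasCompactSupport θ := hasCompactSupport_mul_comp_div hχc hχs hψc
  have hθ' : ∀ v, Continuous fun p => fderiv ℝ θ p v := fun v =>
    (hθd.continuous_fderiv (by simp)).clm_apply continuous_const
  have hθ'c : ∀ v, HasCompactSupport fun p => fderiv ℝ θ p v := fun v => hθc.fderiv_apply ℝ v
  have hint : ∀ {k : ℝ → ℝ} (v : ℝ × ℝ), Continuous k →
      Integrable fun p : ℝ × ℝ => k (p.2 / p.1) * fderiv ℝ θ p v := by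
    intro k v hk
    refine Continuous.integrable_of_hasCompactSupport ?_ (hθ'c v).mul_left
    refine continuous_of_tsupport fun p hp => ?_
    have h₀ : p.1 ≠ 0 := (fst_pos_of_mem_tsupport hχc hχs hψc
      (tsupport_fderiv_apply_subset ℝ v (tsupport_mul_subset_right hp))).ne'
    exact (hk.continuousAt.comp (continuousAt_snd.div continuousAt_fst h₀)).mul
      (hθ' v).continuousAt
  have hχ' : Continuous (deriv χ) := hχ.continuous_deriv (by simp)
  have hψ' : Continuous (deriv ψ) := hψ.continuous_deriv (by simp)
  have hinner : ∀ t, ∫ x, (f (x / t) * fderiv ℝ θ (t, x) (1, 0) +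
      g (x / t) * fderiv ℝ θ (t, x) (0, 1)) =
      t * deriv χ t * (∫ ξ, f ξ * ψ ξ) + χ t * ∫ ξ, (g ξ - ξ * f ξ) * deriv ψ ξ := by
    intro t
    by_cases ht : t ∈ tsupport χ
    · have htpos : 0 < t := hχs ht
      have hsub := Measure.integral_comp_mul_left (fun x => f (x / t) * fderiv ℝ θ (t, x) (1, 0) +
        g (x / t) * fderiv ℝ θ (t, x) (0, 1)) t
      rw [abs_of_pos (inv_pos.2 htpos), smul_eq_mul, eq_comm, inv_mul_eq_iff_eq_mul₀ htpos.ne']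
        at hsub
      have hpt : ∀ ξ, f (t * ξ / t) * fderiv ℝ θ (t, t * ξ) (1, 0) +
          g (t * ξ / t) * fderiv ℝ θ (t, t * ξ) (0, 1) =
          deriv χ t * (f ξ * ψ ξ) + t⁻¹ * χ t * ((g ξ - ξ * f ξ) * deriv ψ ξ) := by
        intro ξ
        rw [hθ, fderiv_mul_comp_div_apply hχ hψ htpos.ne',
          fderiv_mul_comp_div_apply hχ hψ htpos.ne', mul_div_cancel_left₀ _ htpos.ne']
        field_simp
        ring
      rw [hsub]
      simp_rw [hpt]
      rw [integral_add, integral_const_mul, integral_const_mul]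
      · field_simp
      · exact ((hf.mul hψ.continuous).integrable_of_hasCompactSupport hψc.mul_left).const_mul _
      · exact (((hg.sub (continuous_id.mul hf)).mul hψ').integrable_of_hasCompactSupport
          hψc.deriv.mul_left).const_mul _
    · have hz : ∀ x v, fderiv ℝ θ (t, x) v = 0 := by
        intro x v
        by_contra hne
        obtain ⟨q, hq, hqt⟩ := tsupport_mul_comp_div_subset hχc hχs hψc
          (tsupport_fderiv_apply_subset ℝ v (subset_tsupport _ hne))
        have hq₁ : q.1 = t := congrArg Prod.fst hqt
        exact ht (hq₁ ▸ hq.1)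
      have h₁ : χ t = 0 := image_eq_zero_of_notMem_tsupport ht
      have h₂ : deriv χ t = 0 :=
        image_eq_zero_of_notMem_tsupport fun h => ht (tsupport_deriv_subset h)
      simp [hz, h₁, h₂]
  have hparts : ∫ t, t * deriv χ t = - ∫ t, χ t := by
    have h := integral_mul_deriv_eq_deriv_mul_of_integrable (u := fun t : ℝ => t) (u' := fun _ => 1)
      (v := χ) (v' := deriv χ) (fun x _ => hasDerivAt_id x)
      (fun x _ => (hχ.differentiable (by simp) x).hasDerivAt)
      ((continuous_id.mul hχ').integrable_of_hasCompactSupport hχc.deriv.mul_left)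
      ((continuous_const.mul hχ.continuous).integrable_of_hasCompactSupport hχc.mul_left)
      ((continuous_id.mul hχ.continuous).integrable_of_hasCompactSupport hχc.mul_left)
    simpa using h
  have hsum : Integrable (fun p : ℝ × ℝ => f (p.2 / p.1) * fderiv ℝ θ p (1, 0) +
      g (p.2 / p.1) * fderiv ℝ θ p (0, 1)) (volume.prod volume) := (hint _ hf).add (hint _ hg)
  rw [Measure.volume_eq_prod, integral_prod _ hsum]
  simp only [hinner]
  rw [integral_add, integral_mul_const, integral_mul_const, hparts]
  · ring
  · exact ((continuous_id.mul hχ').integrable_of_hasCompactSupport hχc.deriv.mul_left).mul_const _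
  · exact (hχ.continuous.integrable_of_hasCompactSupport hχc).mul_const _

end SelfSimilarTestFunction

/-- In the self-similar variable a solution satisfies `(F(V) - ξ V)' + V = 0` weakly wherever it is
continuous. -/
theorem IsSelfSimilarSolution.integral_deriv_sub_integral_eq_zero {n : ℕ}
    {F : (Fin n → ℝ) → (Fin n → ℝ)} {V W : ℝ → Fin n → ℝ} (hsol : IsSelfSimilarSolution n F V)
    (hF : Continuous F) (hW : Continuous W) {α β : ℝ} (hα : 0 ≤ α) (hVW : EqOn V W (Ioo α β))
    {ψ : ℝ → ℝ} (hψ : ContDiff ℝ (⊤ : ℕ∞) ψ) (hψc : HasCompactSupport ψ)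
    (hψs : tsupport ψ ⊆ Ioo α β) (i : Fin n) :
    (∫ ξ, (F (W ξ) i - ξ * W ξ i) * deriv ψ ξ) - ∫ ξ, W ξ i * ψ ξ = 0 := by
  let χ : ContDiffBump (2 : ℝ) := ⟨1 / 2, 1, by norm_num, by norm_num⟩
  have hχ : ContDiff ℝ (⊤ : ℕ∞) χ := χ.contDiff
  have hχc : HasCompactSupport χ := χ.hasCompactSupport
  have hχs : tsupport χ ⊆ Ioi 0 := by
    rw [χ.tsupport_eq, Real.closedBall_eq_Icc]
    intro t ht
    have h₁ : (2 : ℝ) - 1 ≤ t := ht.1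
    exact mem_Ioi.2 (by linarith)
  have hsupp := tsupport_mul_comp_div_subset hχc hχs hψc
  set θ : ℝ × ℝ → ℝ := fun p => χ p.1 * ψ (p.2 / p.1) with hθ
  have hθd : ContDiff ℝ (⊤ : ℕ∞) θ := contDiff_mul_comp_div hχ hχc hχs hψ hψc
  have hθc : HasCompactSupport θ := hasCompactSupport_mul_comp_div hχc hχs hψc
  let e : ℝ →L[ℝ] (Fin n → ℝ) := ContinuousLinearMap.single ℝ (fun _ => ℝ) i
  have hts : tsupport (fun p => e (θ p)) ⊆ tsupport θ :=
    closure_mono (Function.support_comp_subset (map_zero e) θ)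
  have hzero := hsol (fun p => e (θ p)) (e.contDiff.comp hθd) (hθc.comp_left (map_zero e)) (by
    intro p hp
    obtain ⟨q, hq, rfl⟩ := hsupp (hts hp)
    have hq₁ : 0 < q.1 := hχs hq.1
    exact ⟨hq₁, mul_pos hq₁ (hα.trans_lt (hψs hq.2).1)⟩)
  have hfd : ∀ p v, fderiv ℝ (fun p => e (θ p)) p v = Pi.single i (fderiv ℝ θ p v) := by
    intro p v
    have h : HasFDerivAt (fun p => e (θ p)) (e.comp (fderiv ℝ θ p)) p :=
      e.hasFDerivAt.comp p (hθd.differentiable (by simp) p).hasFDerivAt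
    rw [h.fderiv]
    rfl
  have hpt : ∀ p : ℝ × ℝ, V (p.2 / p.1) ⬝ᵥ fderiv ℝ (fun p => e (θ p)) p (1, 0) +
      F (V (p.2 / p.1)) ⬝ᵥ fderiv ℝ (fun p => e (θ p)) p (0, 1) =
      W (p.2 / p.1) i * fderiv ℝ θ p (1, 0) + F (W (p.2 / p.1)) i * fderiv ℝ θ p (0, 1) := by
    intro p
    rw [hfd, hfd, dotProduct_single, dotProduct_single]
    by_cases hp : p ∈ tsupport θ
    · obtain ⟨q, hq, rfl⟩ := hsupp hp
      have hq₁ : q.1 ≠ 0 := (mem_Ioi.1 (hχs hq.1)).ne'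
      have hq₂ : q.1 * q.2 / q.1 = q.2 := mul_div_cancel_left₀ _ hq₁
      simp only [hq₂, hVW (hψs hq.2)]
    · have hz : fderiv ℝ θ p = 0 :=
        image_eq_zero_of_notMem_tsupport fun h => hp (tsupport_fderiv_subset ℝ h)
      simp [hz]
  simp_rw [hpt] at hzero
  rw [hθ, integral_selfSimilar_mul_fderiv (f := fun ξ => W ξ i) (g := fun ξ => F (W ξ) i)
    (by fun_prop) (by fun_prop) hχ hχc hχs hψ hψc] at hzero
  exact (mul_eq_zero.1 hzero).resolve_left (ne_of_gt χ.integral_pos)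

/-- The integrated form of the self-similar equation on an interval of continuity. -/
theorem IsSelfSimilarSolution.exists_add_integral_eq_const {n : ℕ}
    {F : (Fin n → ℝ) → (Fin n → ℝ)} {V W : ℝ → Fin n → ℝ} (hsol : IsSelfSimilarSolution n F V)
    (hF : Continuous F) (hW : Continuous W) {α β : ℝ} (hα : 0 ≤ α) (hαβ : α < β)
    (hVW : EqOn V W (Ioo α β)) (i : Fin n) :
    ∃ c : ℝ, ∀ ξ ∈ Ioo α β, F (W ξ) i - ξ * W ξ i + ∫ t in α..ξ, W t i = c := by
  have hWi : Continuous fun ξ => W ξ i := by fun_prop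
  have hder : ∀ x, HasDerivAt (fun x => ∫ t in α..x, W t i) (W x i) x := fun x =>
    (hWi.integral_hasStrictDerivAt α x).hasDerivAt
  have hP : Continuous fun x => ∫ t in α..x, W t i :=
    continuous_iff_continuousAt.2 fun x => (hder x).continuousAt
  have hQ : Continuous fun ξ => F (W ξ) i - ξ * W ξ i := by fun_prop
  refine (hQ.add hP).exists_eqOn_const_of_integral_mul_deriv_eq_zero hαβ fun ψ hψ hψc hψs => ?_
  have hψ' : Continuous (deriv ψ) := hψ.continuous_deriv (by simp)
  have hPψ' := (hP.mul hψ').integrable_of_hasCompactSupport (μ := volume) hψc.deriv.mul_left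
  have hparts := integral_mul_deriv_eq_deriv_mul_of_integrable (v := ψ) (v' := deriv ψ)
    (fun x _ => hder x) (fun x _ => (hψ.differentiable (by simp) x).hasDerivAt) hPψ'
    ((hWi.mul hψ.continuous).integrable_of_hasCompactSupport hψc.mul_left)
    ((hP.mul hψ.continuous).integrable_of_hasCompactSupport hψc.mul_left)
  have hweak := hsol.integral_deriv_sub_integral_eq_zero hF hW hα hVW hψ hψc hψs i
  have hsum := integral_add
    ((hQ.mul hψ').integrable_of_hasCompactSupport (μ := volume) hψc.deriv.mul_left) hPψ'
  simp only [Pi.mul_apply] at hsum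
  simp only [Pi.add_apply, add_mul]
  rw [hsum, hparts]
  linarith

/-- The product of `y - x` with a function continuous at `x` is differentiable at `x`. -/
theorem ContinuousAt.differentiableAt_sub_mul {f : ℝ → ℝ} {x : ℝ} (hf : ContinuousAt f x) :
    DifferentiableAt ℝ (fun y => (y - x) * f y) x := by
  refine HasDerivAt.differentiableAt (f' := f x) (hasDerivAt_iff_isLittleO.2 ?_)
  have h : (fun y => f y - f x) =o[𝓝 x] fun _ => (1 : ℝ) := by
    rw [isLittleO_one_iff]
    simpa using hf.sub_const (f x)
  refine ((isBigO_refl (fun y => y - x) (𝓝 x)).mul_isLittleO h).congr (fun y => ?_) fun y => ?_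
  · simp only [smul_eq_mul]
    ring
  · ring

theorem jacobianMatrix_mulVec {n : ℕ} (F : (Fin n → ℝ) → (Fin n → ℝ)) (U w : Fin n → ℝ) :
    jacobianMatrix F U *ᵥ w = fderiv ℝ F U w := by
  have h : jacobianMatrix F U = LinearMap.toMatrix' (fderiv ℝ F U : (Fin n → ℝ) →ₗ[ℝ] _) := by
    ext i j
    simp [jacobianMatrix, LinearMap.toMatrix'_apply]
  rw [h, LinearMap.toMatrix'_mulVec]
  rfl

/-- part (4) of Lemma 2.1. Let `V` be a bounded BV self-similar
solution, let `I = (a,b) ⊆ (0,∞)` be an open interval on which `V` is continuous and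
nowhere a.e. constant, and suppose there are `C¹` functions `λ`, `r` defined on an open
neighborhood of the closure of `V(I)` such that `r(W)` is a unit eigenvector of `DF(W)`
for the simple eigenvalue `λ(W)`, with `λ(V(ξ)) = ξ` and genuine nonlinearity
`∇λ(V(ξ)) · r(V(ξ)) ≠ 0` on `I`. Then `V` is differentiable at every point of `I`. -/
theorem differentiable_on_rarefaction (n : ℕ) (hn : 1 ≤ n)
    (F : (Fin n → ℝ) → (Fin n → ℝ)) (hF : ContDiff ℝ (⊤ : ℕ∞) F)
    (V : ℝ → Fin n → ℝ)
    (hbd : ∃ M : ℝ, ∀ ξ, 0 < ξ → ‖V ξ‖ ≤ M)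
    (hBV : BoundedVariationOn V (Set.Ioi 0))
    (hsol : IsSelfSimilarSolution n F V)
    (a b : ℝ) (hab : a < b) (hI : Set.Ioo a b ⊆ Set.Ioi 0)
    (hcont : ContinuousOn V (Set.Ioo a b))
    (hnc : ∀ a' b' : ℝ, a' < b' → Set.Ioo a' b' ⊆ Set.Ioo a b →
      ¬ ∃ c : Fin n → ℝ,
        ∀ᵐ ξ ∂(volume : Measure ℝ), ξ ∈ Set.Ioo a' b' → V ξ = c)
    (lam : (Fin n → ℝ) → ℝ) (r : (Fin n → ℝ) → (Fin n → ℝ))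
    (O : Set (Fin n → ℝ)) (hO : IsOpen O)
    (hVIO : closure (V '' Set.Ioo a b) ⊆ O)
    (hlam : ContDiffOn ℝ 1 lam O) (hr : ContDiffOn ℝ 1 r O)
    (hunit : ∀ W ∈ O, ‖r W‖ = 1)
    (heig : ∀ W ∈ O, (jacobianMatrix F W) *ᵥ (r W) = lam W • r W)
    (hsimple : ∀ W ∈ O, (jacobianMatrix F W).charpoly.rootMultiplicity (lam W) = 1)
    (hlamV : ∀ ξ ∈ Set.Ioo a b, lam (V ξ) = ξ)
    (hgnl : ∀ ξ ∈ Set.Ioo a b, fderiv ℝ lam (V ξ) (r (V ξ)) ≠ 0) :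
    ∀ ξ ∈ Set.Ioo a b, DifferentiableAt ℝ V ξ := by
  intro ξ₀ hξ₀
  obtain ⟨α, haα, hα⟩ := exists_between hξ₀.1
  obtain ⟨β, hβ, hβb⟩ := exists_between hξ₀.2
  have hαβ : α < β := hα.trans hβ
  have hα0 : 0 ≤ α := le_of_lt (hI ⟨haα, hα.trans hξ₀.2⟩)
  have hIcc : Icc α β ⊆ Ioo a b := Icc_subset_Ioo haα hβb
  obtain ⟨W, hW, hVW⟩ : ∃ W : ℝ → Fin n → ℝ, Continuous W ∧ EqOn V W (Ioo α β) :=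
    ⟨IccExtend hαβ.le ((Icc α β).domRestrict V), (hcont.mono hIcc).domRestrict.Icc_extend',
      fun ξ hξ => (IccExtend_of_mem hαβ.le ((Icc α β).domRestrict V) (Ioo_subset_Icc_self hξ)).symm⟩
  have hnhds : Ioo α β ∈ 𝓝 ξ₀ := Ioo_mem_nhds hα hβ
  have hVO : V ξ₀ ∈ O := hVIO (subset_closure (mem_image_of_mem V hξ₀))
  have hFd : HasFDerivAt F (fderiv ℝ F (V ξ₀)) (V ξ₀) :=
    (hF.differentiable (by simp) _).hasFDerivAt
  have hlamd : HasFDerivAt lam (fderiv ℝ lam (V ξ₀)) (V ξ₀) :=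
    ((hlam.contDiffAt (hO.mem_nhds hVO)).differentiableAt one_ne_zero).hasFDerivAt
  refine DifferentiableAt.of_comp_injective_fderiv (hcont.continuousAt (Ioo_mem_nhds hξ₀.1 hξ₀.2))
    ((hFd.sub ((hasFDerivAt_id (V ξ₀)).const_smul ξ₀)).prodMk hlamd) ?_ ?_
  · refine (injective_iff_map_eq_zero _).2 fun w hw => ?_
    have hw₁ : fderiv ℝ F (V ξ₀) w - ξ₀ • w = 0 := congrArg Prod.fst hw
    have hw₂ : fderiv ℝ lam (V ξ₀) w = 0 := congrArg Prod.snd hw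
    have hr0 : r (V ξ₀) ≠ 0 := fun h => by simpa [h] using hunit _ hVO
    obtain ⟨c, rfl⟩ := Matrix.exists_smul_eq_of_rootMultiplicity_charpoly_eq_one
      (hsimple _ hVO) hr0 (heig _ hVO) (w := w) (by
        rw [jacobianMatrix_mulVec, hlamV _ hξ₀, sub_eq_zero.1 hw₁])
    rw [map_smul, smul_eq_mul] at hw₂
    rw [(mul_eq_zero.1 hw₂).resolve_right (hgnl _ hξ₀), zero_smul]
  · refine DifferentiableAt.prodMk (differentiableAt_pi.2 fun i => ?_) ?_
    · obtain ⟨c, hc⟩ :=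
        hsol.exists_add_integral_eq_const hF.continuous hW hα0 hαβ hVW i
      have hWi : Continuous fun ξ => W ξ i := by fun_prop
      refine (((hWi.continuousAt.differentiableAt_sub_mul).sub
        (hWi.integral_hasStrictDerivAt α ξ₀).hasDerivAt.differentiableAt).const_add
          c).congr_of_eventuallyEq ?_
      filter_upwards [hnhds] with ξ hξ
      simp only [Pi.sub_apply, Pi.smul_apply, id, smul_eq_mul, hVW hξ, ← hc ξ hξ]
      ring
    · refine differentiableAt_id.congr_of_eventuallyEq ?_
      filter_upwards [hnhds] with ξ hξ using hlamV ξ (hIcc (Ioo_subset_Icc_self hξ))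
end
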